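/- (Thomas) There is a bijection between the set of r-tuples (P_1,...,P_r) of semistandard Young tableaux and the set of pairs (P, S) where P is a semistandard tableau and S is a Littlewood-Richardson multitableau of shape sh(P), under which cont(P) = Σ_k cont(P_k) and cont(S) = (sh(P_1),...,sh(P_r)). -/

import Mathlib

open Finset Equiv
open scoped Classical

noncomputable section

/-- Value at `g` of the permutation character of `S_n` induced from the trivial character of
the Young subgroup of the composition `c`: the number of colorings of `Fin n` with fiber
sizes given by `c` that are fixed by `g`. -/
def permChar (n : ℕ) (c : ℕ → ℕ) (g : Perm (Fin n)) : ℚ :=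
  Nat.card {f : Fin n → ℕ // (∀ k, Nat.card {x : Fin n // f x = k} = c k) ∧ ∀ x, f (g x) = f x}

/-- Inner product of class functions (real-valued characters) of `S_n`. -/
def innerChar (n : ℕ) (χ ψ : Perm (Fin n) → ℚ) : ℚ :=
  (∑ g : Perm (Fin n), χ g * ψ g) / (n.factorial : ℚ)

/-- The trivial character `χ^{(n)}` of `S_n`. -/
def trivChar (n : ℕ) : Perm (Fin n) → ℚ := fun _ => 1

/-- The sign character `χ^{(1^n)}` of `S_n`. -/
def signChar (n : ℕ) : Perm (Fin n) → ℚ := fun g => ((Perm.sign g : ℤ) : ℚ)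

/-- Permutation character for an integer vector: zero if some entry is negative. -/
def permCharZ (n : ℕ) (c : ℕ → ℤ) (g : Perm (Fin n)) : ℚ :=
  if ∀ k, 0 ≤ c k then permChar n (fun k => (c k).toNat) g else 0

/-- The irreducible character `χ^a` of `S_n` indexed by the partition `a`, given by the
Jacobi–Trudi determinantal formula `χ^a = ∑_σ sgn(σ) φ^{(a_i - i + σ(i))_i}`. -/
def irrChar (n : ℕ) (a : ℕ → ℕ) (g : Perm (Fin n)) : ℚ :=
  ∑ σ : Perm (Fin n), ((Perm.sign σ : ℤ) : ℚ) *
    permCharZ n (fun i => if h : i < n then (a i : ℤ) - i + ((σ ⟨i, h⟩ : Fin n) : ℕ) else 0) g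

/-- Kronecker coefficient `k(a,b,c) = ⟨χ^a ⊗ χ^b, χ^c⟩`. -/
def kron (n : ℕ) (a b c : ℕ → ℕ) : ℚ :=
  innerChar n (fun g => irrChar n a g * irrChar n b g) (irrChar n c)

/-- Extend a vector indexed by `Fin p` to `ℕ` by zeros. -/
def extc {p : ℕ} (l : Fin p → ℕ) : ℕ → ℕ := fun i => if h : i < p then l ⟨i, h⟩ else 0

/-- Dominance order: `a ⊵ b`. -/
def Dominates (a b : ℕ → ℕ) : Prop :=
  ∀ k, ∑ i ∈ Finset.range k, b i ≤ ∑ i ∈ Finset.range k, a i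

/-- Conjugate (transpose) of a partition with at most `n` parts. -/
def conjFun (n : ℕ) (a : ℕ → ℕ) : ℕ → ℕ :=
  fun j => ((Finset.range n).filter (fun i => j < a i)).card

/-- `a` is a partition of `n` (weakly decreasing, supported on the first `n` parts). -/
def IsPartitionFun (n : ℕ) (a : ℕ → ℕ) : Prop :=
  (∀ i j, i ≤ j → a j ≤ a i) ∧ (∀ i, n ≤ i → a i = 0) ∧ ∑ i ∈ Finset.range n, a i = n

/-- The weakly decreasing sequence of parts of `P : Nat.Partition n`. -/
def pf {n : ℕ} (P : n.Partition) : ℕ → ℕ :=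
  fun i => ((P.parts.sort (· ≤ ·)).reverse).getD i 0

/-- The parts of `P : Nat.Partition n` as a vector of length `n`. -/
def pfin {n : ℕ} (P : n.Partition) : Fin n → ℕ := fun k => pf P k

/-- Number of cells of the skew shape `a/b` where the filling `T` has entry `k`. -/
def skewContent (a b : ℕ → ℕ) (T : ℕ → ℕ → ℕ) (k : ℕ) : ℕ :=
  Nat.card {p : ℕ × ℕ // b p.1 ≤ p.2 ∧ p.2 < a p.1 ∧ T p.1 p.2 = k}

/-- Number of cells of the skew shape `a/b`. -/
def skewSize (a b : ℕ → ℕ) : ℕ :=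
  Nat.card {p : ℕ × ℕ // b p.1 ≤ p.2 ∧ p.2 < a p.1}

/-- `T` is a semistandard filling of the shape `a` (zero outside, rows weakly increasing,
columns strictly increasing). -/
def IsSSYT (a : ℕ → ℕ) (T : ℕ → ℕ → ℕ) : Prop :=
  (∀ i j, a i ≤ j → T i j = 0) ∧
  (∀ i j₁ j₂, j₁ ≤ j₂ → j₂ < a i → T i j₁ ≤ T i j₂) ∧
  (∀ i₁ i₂ j, i₁ < i₂ → j < a i₂ → T i₁ j < T i₂ j)

/-- The Kostka number: the number of semistandard Young tableaux of shape `a`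
and content `c`. -/
def kostka (a c : ℕ → ℕ) : ℕ :=
  Nat.card {T : ℕ → ℕ → ℕ // IsSSYT a T ∧ ∀ k, skewContent a (fun _ => 0) T k = c k}

/-- Number of entries equal to `k` in the prefix of the (right-to-left, top-to-bottom)
reading word of `T` ending at position `(i,j)`. -/
def lrCount (a b : ℕ → ℕ) (T : ℕ → ℕ → ℕ) (i j k : ℕ) : ℕ :=
  Nat.card {p : ℕ × ℕ //
    (p.1 < i ∨ (p.1 = i ∧ j ≤ p.2)) ∧ b p.1 ≤ p.2 ∧ p.2 < a p.1 ∧ T p.1 p.2 = k}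

/-- `T` is a Littlewood–Richardson skew tableau of shape `a/b`: semistandard and its
reverse reading word is a lattice word. -/
def IsLR (a b : ℕ → ℕ) (T : ℕ → ℕ → ℕ) : Prop :=
  (∀ i j, ¬(b i ≤ j ∧ j < a i) → T i j = 0) ∧
  (∀ i j₁ j₂, b i ≤ j₁ → j₁ ≤ j₂ → j₂ < a i → T i j₁ ≤ T i j₂) ∧
  (∀ i₁ i₂ j, i₁ < i₂ → b i₁ ≤ j → j < a i₁ → b i₂ ≤ j → j < a i₂ → T i₁ j < T i₂ j) ∧
  (∀ i j k, lrCount a b T i j (k + 1) ≤ lrCount a b T i j k)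

/-- A Littlewood–Richardson multitableau of shape `α` with `r` parts: a chain of
partitions `0 = α(0) ⊆ α(1) ⊆ ⋯ ⊆ α(r) = α` together with Littlewood–Richardson
fillings of the successive skew shapes. -/
structure LRMultiF (r : ℕ) (α : ℕ → ℕ) where
  chain : Fin (r + 1) → ℕ → ℕ
  antitone : ∀ k i j, i ≤ j → chain k j ≤ chain k i
  zero : ∀ i, chain 0 i = 0
  last : ∀ i, chain (Fin.last r) i = α i
  mono : ∀ (k : Fin r) (i : ℕ), chain k.castSucc i ≤ chain k.succ i
  T : Fin r → ℕ → ℕ → ℕ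
  lr : ∀ k : Fin r, IsLR (chain k.succ) (chain k.castSucc) (T k)

/-- Content of the `k`-th tableau of a Littlewood–Richardson multitableau. -/
def LRMultiF.cont {r : ℕ} {α : ℕ → ℕ} (M : LRMultiF r α) (k : Fin r) : ℕ → ℕ :=
  skewContent (M.chain k.succ) (M.chain k.castSucc) (M.T k)

/-- Size of the `k`-th tableau of a Littlewood–Richardson multitableau. -/
def LRMultiF.size {r : ℕ} {α : ℕ → ℕ} (M : LRMultiF r α) (k : Fin r) : ℕ :=
  skewSize (M.chain k.succ) (M.chain k.castSucc)

/-- `LR(α,β;ν)`: pairs of Littlewood–Richardson multitableaux of shapes `α`, `β`,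
type `ν`, with equal contents. -/
def LRPairs (r : ℕ) (α β : ℕ → ℕ) (ν : Fin r → ℕ) :=
  {TS : LRMultiF r α × LRMultiF r β //
    (∀ k, TS.1.size k = ν k) ∧ (∀ k, TS.2.size k = ν k) ∧ ∀ k, TS.1.cont k = TS.2.cont k}

/-- `LR*(α,β;ν)`: pairs of Littlewood–Richardson multitableaux of shapes `α`, `β`,
type `ν`, with termwise conjugate contents. -/
def LRPairsStar (n r : ℕ) (α β : ℕ → ℕ) (ν : Fin r → ℕ) :=
  {TS : LRMultiF r α × LRMultiF r β //
    (∀ k, TS.1.size k = ν k) ∧ (∀ k, TS.2.size k = ν k) ∧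
      ∀ k m, TS.2.cont k m = conjFun n (TS.1.cont k) m}

/-- `lr(α,β;ν)`. -/
def lrNum (r : ℕ) (α β : ℕ → ℕ) (ν : Fin r → ℕ) : ℕ := Nat.card (LRPairs r α β ν)

/-- `lr*(α,β;ν)`. -/
def lrStarNum (n r : ℕ) (α β : ℕ → ℕ) (ν : Fin r → ℕ) : ℕ :=
  Nat.card (LRPairsStar n r α β ν)

/-- A semistandard Young tableau (of arbitrary partition shape). -/
structure SSYTP where
  shape : ℕ → ℕ
  T : ℕ → ℕ → ℕ
  antitone : ∀ i j, i ≤ j → shape j ≤ shape i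
  finite : ∃ N, ∀ i, N ≤ i → shape i = 0
  ssyt : IsSSYT shape T

/-- Content of a semistandard Young tableau. -/
def SSYTP.cont (P : SSYTP) : ℕ → ℕ := skewContent P.shape (fun _ => 0) P.T

/-- The multiset of entries of a matrix. -/
def entriesM {p q : ℕ} (A : Fin p → Fin q → ℕ) : Multiset ℕ :=
  (Finset.univ : Finset (Fin p × Fin q)).val.map (fun ij => A ij.1 ij.2)

/-- The π-sequence of `A` is the partition `ν` (the weakly decreasing rearrangement of
the entries of `A` is `ν`). -/
def HasPiSeq {p q : ℕ} (A : Fin p → Fin q → ℕ) {n : ℕ} (ν : n.Partition) : Prop :=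
  (entriesM A).filter (· ≠ 0) = ν.parts

end

namespace LittlewoodRichardson

/-- `g` is a Gelfand–Tsetlin pattern with `n` levels and top row `μ`: `g k` is the shape formed
by the entries smaller than `k` of a semistandard tableau of shape `μ` with entries below `n`. -/
structure IsGT (n : ℕ) (μ : ℕ → ℕ) (g : ℕ → ℕ → ℕ) : Prop where
  zero : ∀ i, g 0 i = 0
  top : ∀ k, n ≤ k → ∀ i, g k i = μ i
  le_succ : ∀ k i, g k i ≤ g (k + 1) i
  succ_le : ∀ k i, g (k + 1) (i + 1) ≤ g k i

/-- The number of cells in the first `m` rows of the `k`-th level of `g`. -/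
def rowSum (g : ℕ → ℕ → ℕ) (k m : ℕ) : ℕ := ∑ i ∈ range m, g k i

/-- The number of entries `k` of the tableau encoded by `g`. -/
def weight (n : ℕ) (g : ℕ → ℕ → ℕ) (k : ℕ) : ℕ := rowSum g (k + 1) n - rowSum g k n

lemma rowSum_succ (g : ℕ → ℕ → ℕ) (k m : ℕ) : rowSum g k (m + 1) = rowSum g k m + g k m :=
  sum_range_succ _ _

lemma rowSum_zero (g : ℕ → ℕ → ℕ) (k : ℕ) : rowSum g k 0 = 0 := rfl

namespace IsGT

variable {n : ℕ} {μ : ℕ → ℕ} {g : ℕ → ℕ → ℕ}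

lemma eq_zero (h : IsGT n μ g) {k i : ℕ} (hki : k ≤ i) : g k i = 0 := by
  induction k generalizing i with
  | zero => exact h.zero i
  | succ k ih =>
    obtain ⟨i, rfl⟩ : ∃ j, i = j + 1 := ⟨i - 1, by omega⟩
    have := h.succ_le k i
    have := ih (i := i) (by omega)
    omega

lemma monotone (h : IsGT n μ g) (i : ℕ) : Monotone (g · i) :=
  monotone_nat_of_le_succ fun k => h.le_succ k i

lemma le_top (h : IsGT n μ g) (k i : ℕ) : g k i ≤ μ i := by
  rw [← h.top (max k n) (le_max_right _ _) i]
  exact h.monotone i (le_max_left _ _)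

lemma top_eq_zero (h : IsGT n μ g) {i : ℕ} (hi : n ≤ i) : μ i = 0 := by
  rw [← h.top n le_rfl i, h.eq_zero hi]

lemma top_succ_le (h : IsGT n μ g) (i : ℕ) : μ (i + 1) ≤ μ i := by
  have := h.succ_le n i
  rwa [h.top n le_rfl, h.top (n + 1) (by omega)] at this

lemma top_antitone (h : IsGT n μ g) : Antitone μ := antitone_nat_of_succ_le h.top_succ_le

lemma rowSum_le_succ (h : IsGT n μ g) (k m : ℕ) : rowSum g k m ≤ rowSum g (k + 1) m :=
  sum_le_sum fun i _ => h.le_succ k i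

lemma rowSum_top (h : IsGT n μ g) {k : ℕ} (hk : n ≤ k) (m : ℕ) :
    rowSum g k m = ∑ i ∈ range m, μ i :=
  sum_congr rfl fun i _ => h.top k hk i

lemma weight_eq_zero (h : IsGT n μ g) {k : ℕ} (hk : n ≤ k) : weight n g k = 0 := by
  rw [weight, h.rowSum_top hk, h.rowSum_top (hk.trans (Nat.le_succ k)), Nat.sub_self]

lemma weight_add (h : IsGT n μ g) (k : ℕ) : weight n g k + rowSum g k n = rowSum g (k + 1) n :=
  Nat.sub_add_cancel (h.rowSum_le_succ k n)

end IsGT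

lemma finite_setOf_isGT (n : ℕ) (μ : ℕ → ℕ) : {g | IsGT n μ g}.Finite := by
  let F : {g | IsGT n μ g} → (Fin n → Fin n → Fin (μ 0 + 1)) := fun g k i =>
    ⟨g.1 k i, Nat.lt_succ_of_le ((g.2.le_top k i).trans (g.2.top_antitone (Nat.zero_le _)))⟩
  have hF : Function.Injective F := by
    rintro ⟨g, hg⟩ ⟨g', hg'⟩ h
    ext k i
    by_cases hk : k < n
    · by_cases hi : i < n
      · simpa [F] using congrFun (congrFun h ⟨k, hk⟩) ⟨i, hi⟩
      · simp only
        rw [hg.eq_zero (by omega), hg'.eq_zero (by omega)]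
    · simp only
      rw [hg.top k (by omega), hg'.top k (by omega)]
  exact Finite.of_injective F hF

/-- The finite set of Gelfand–Tsetlin patterns with `n` levels and top row `μ`. -/
noncomputable def patterns (n : ℕ) (μ : ℕ → ℕ) : Finset (ℕ → ℕ → ℕ) :=
  (finite_setOf_isGT n μ).toFinset

lemma mem_patterns {n : ℕ} {μ : ℕ → ℕ} {g : ℕ → ℕ → ℕ} : g ∈ patterns n μ ↔ IsGT n μ g := by
  simp [patterns]

/-! ### Truncated Bender–Knuth involutions -/

/-- Bender–Knuth reflection of the row `p` between the rows `o` and `q` of a pattern, leaving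
the entries before `m` and, in position `m`, the last `e` cells fixed. -/
def toggleRow (o p q : ℕ → ℕ) (m e i : ℕ) : ℕ :=
  if i < m then p i
  else max (o i) (q (i + 1)) + (if i = m then q i - e else min (q i) (o (i - 1))) - p i

/-- Apply `toggleRow` to level `k + 1` of a pattern. -/
def toggle (g : ℕ → ℕ → ℕ) (k m e : ℕ) : ℕ → ℕ → ℕ :=
  Function.update g (k + 1) (toggleRow (g k) (g (k + 1)) (g (k + 2)) m e)

/-- The condition under which `toggle` preserves the interlacing conditions. -/
def Togglable (g : ℕ → ℕ → ℕ) (k m e : ℕ) : Prop :=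
  g (k + 1) m + e ≤ g (k + 2) m ∧ ∀ i, m = i + 1 → g (k + 2) m ≤ e + g k i

lemma toggle_self (g : ℕ → ℕ → ℕ) (k m e : ℕ) :
    toggle g k m e (k + 1) = toggleRow (g k) (g (k + 1)) (g (k + 2)) m e :=
  Function.update_self ..

lemma toggle_of_ne (g : ℕ → ℕ → ℕ) {k l : ℕ} (m e : ℕ) (h : l ≠ k + 1) :
    toggle g k m e l = g l :=
  Function.update_of_ne h ..

lemma toggle_of_lt (g : ℕ → ℕ → ℕ) {k m e i : ℕ} (h : i < m) (l : ℕ) :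
    toggle g k m e l i = g l i := by
  by_cases hl : l = k + 1
  · subst hl
    rw [toggle_self, toggleRow, if_pos h]
  · rw [toggle_of_ne g m e hl]

lemma rowSum_toggle_of_le (g : ℕ → ℕ → ℕ) {k m e i : ℕ} (h : i ≤ m) (l : ℕ) :
    rowSum (toggle g k m e) l i = rowSum g l i :=
  sum_congr rfl fun j hj => toggle_of_lt g (by rw [mem_range] at hj; omega) l

lemma rowSum_toggle_of_ne (g : ℕ → ℕ → ℕ) {k l : ℕ} (m e i : ℕ) (h : l ≠ k + 1) :
    rowSum (toggle g k m e) l i = rowSum g l i := by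
  rw [rowSum, toggle_of_ne g m e h, rowSum]

namespace IsGT

variable {n : ℕ} {μ : ℕ → ℕ} {g : ℕ → ℕ → ℕ} {k m e : ℕ}

lemma toggle_bounds (h : IsGT n μ g) (ht : Togglable g k m e) (i : ℕ) :
    g k i ≤ toggle g k m e (k + 1) i ∧ toggle g k m e (k + 1) i ≤ g (k + 2) i ∧
      g (k + 2) (i + 1) ≤ toggle g k m e (k + 1) i ∧
      ∀ j, i = j + 1 → toggle g k m e (k + 1) i ≤ g k j := by
  obtain ⟨h₁, h₂⟩ := ht
  have a₁ := h.le_succ k i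
  have a₂ : g (k + 1) i ≤ g (k + 2) i := h.le_succ (k + 1) i
  have a₃ : g (k + 2) (i + 1) ≤ g (k + 1) i := h.succ_le (k + 1) i
  rw [toggle_self, toggleRow]
  rcases i with _ | i
  · by_cases hm : 0 < m
    · simp only [hm, if_true]
      exact ⟨a₁, a₂, a₃, by omega⟩
    · obtain rfl : m = 0 := by omega
      simp only [lt_irrefl, if_false, if_true]
      exact ⟨by omega, by omega, by omega, by omega⟩
  · have a₄ := h.succ_le k i
    rcases lt_trichotomy (i + 1) m with hm | hm | hm
    · simp only [hm, if_true]
      refine ⟨a₁, a₂, a₃, ?_⟩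
      rintro j hj
      obtain rfl : i = j := by omega
      exact a₄
    · subst hm
      have := h₂ i rfl
      simp only [lt_irrefl, if_false, if_true]
      refine ⟨by omega, by omega, by omega, ?_⟩
      rintro j hj
      obtain rfl : i = j := by omega
      omega
    · rw [if_neg (by omega), if_neg (by omega), Nat.add_sub_cancel]
      refine ⟨by omega, by omega, by omega, ?_⟩
      rintro j hj
      obtain rfl : i = j := by omega
      omega

lemma toggle (h : IsGT n μ g) (ht : Togglable g k m e) (hk : k + 1 < n) :
    IsGT n μ (toggle g k m e) := by
  have b := h.toggle_bounds ht
  refine ⟨fun i => ?_, fun l hl i => ?_, fun l i => ?_, fun l i => ?_⟩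
  · rw [toggle_of_ne g m e (by omega), h.zero]
  · rw [toggle_of_ne g m e (by omega), h.top l hl]
  · by_cases hl : l = k + 1
    · subst hl
      rw [toggle_of_ne g m e (l := k + 1 + 1) (by omega)]
      exact (b i).2.1
    · rw [toggle_of_ne g m e hl]
      by_cases hl' : l = k
      · subst hl'
        exact (b i).1
      · rw [toggle_of_ne g m e (by omega)]
        exact h.le_succ l i
  · by_cases hl : l = k + 1
    · subst hl
      rw [toggle_of_ne g m e (l := k + 1 + 1) (by omega)]
      exact (b i).2.2.1
    · rw [toggle_of_ne g m e hl]
      by_cases hl' : l = k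
      · subst hl'
        exact (b (i + 1)).2.2.2 i rfl
      · rw [toggle_of_ne g m e (by omega)]
        exact h.succ_le l i

lemma toggle_toggle (h : IsGT n μ g) (ht : Togglable g k m e) :
    LittlewoodRichardson.toggle (LittlewoodRichardson.toggle g k m e) k m e = g := by
  funext l i
  by_cases hl : l = k + 1
  swap
  · rw [toggle_of_ne _ m e hl, toggle_of_ne _ m e hl]
  subst hl
  have b := h.toggle_bounds ht i
  obtain ⟨h₁, h₂⟩ := ht
  have a₁ := h.le_succ k i
  have a₂ : g (k + 1) i ≤ g (k + 2) i := h.le_succ (k + 1) i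
  have a₃ : g (k + 2) (i + 1) ≤ g (k + 1) i := h.succ_le (k + 1) i
  rw [toggle_self, toggle_of_ne g m e (l := k) (by omega),
    toggle_of_ne g m e (l := k + 2) (by omega), toggle_self] at *
  simp only [toggleRow] at *
  rcases i with _ | i
  · by_cases hm : 0 < m
    · simp only [hm, if_true]
    · obtain rfl : m = 0 := by omega
      simp only [lt_irrefl, if_false, if_true] at *
      omega
  · have a₄ := h.succ_le k i
    rcases lt_trichotomy (i + 1) m with hm | hm | hm
    · simp only [hm, if_true]
    · subst hm
      have := h₂ i rfl
      simp only [lt_irrefl, if_false, if_true] at *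
      omega
    · simp only [if_neg (show ¬ i + 1 < m by omega), if_neg (show ¬ i + 1 = m by omega),
        Nat.add_sub_cancel] at *
      omega

lemma rowSum_toggle_aux (h : IsGT n μ g) (ht : Togglable g k m e) (N : ℕ) :
    rowSum (LittlewoodRichardson.toggle g k m e) (k + 1) (m + N + 1) + rowSum g (k + 1) (m + N + 1)
        + e + rowSum g k m + rowSum g (k + 2) m + min (g (k + 2) (m + N + 1)) (g k (m + N)) =
      2 * rowSum g (k + 1) m + rowSum g k (m + N + 1) + rowSum g (k + 2) (m + N + 1) +
        g (k + 2) (m + N + 1) := by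
  induction N with
  | zero =>
    have a₁ := h.le_succ k m
    have a₃ : g (k + 2) (m + 1) ≤ g (k + 1) m := h.succ_le (k + 1) m
    have := ht.1
    simp only [rowSum_succ, add_zero, rowSum_toggle_of_le g le_rfl, toggle_self, toggleRow,
      lt_irrefl, if_false, if_true]
    omega
  | succ N ih =>
    have a₁ := h.le_succ k (m + N + 1)
    have a₂ : g (k + 1) (m + N + 1) ≤ g (k + 2) (m + N + 1) := h.le_succ (k + 1) (m + N + 1)
    have a₃ : g (k + 2) (m + N + 1 + 1) ≤ g (k + 1) (m + N + 1) := h.succ_le (k + 1) (m + N + 1)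
    have a₄ := h.succ_le k (m + N)
    have key : LittlewoodRichardson.toggle g k m e (k + 1) (m + N + 1) + g (k + 1) (m + N + 1) =
        max (g k (m + N + 1)) (g (k + 2) (m + N + 1 + 1)) +
          min (g (k + 2) (m + N + 1)) (g k (m + N)) := by
      rw [toggle_self, toggleRow, if_neg (by omega), if_neg (by omega), Nat.add_sub_cancel]
      omega
    rw [show m + (N + 1) + 1 = m + N + 1 + 1 by omega, show m + (N + 1) = m + N + 1 by omega]
    simp only [rowSum_succ _ _ (m + N + 1)]
    omega

lemma rowSum_toggle (h : IsGT n μ g) (ht : Togglable g k m e) (hm : m < n) (hk : k + 1 < n) :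
    rowSum (LittlewoodRichardson.toggle g k m e) (k + 1) n + rowSum g (k + 1) n
        + e + rowSum g k m + rowSum g (k + 2) m =
      2 * rowSum g (k + 1) m + rowSum g k n + rowSum g (k + 2) n := by
  have := h.rowSum_toggle_aux ht (n - 1 - m)
  rw [show m + (n - 1 - m) + 1 = n by omega, h.eq_zero (k := k + 2) (i := n) (by omega)] at this
  omega

end IsGT

/-! ### Schur polynomials and alternants -/

open MvPolynomial in
/-- The Schur polynomial in `n` variables. -/
noncomputable def schur (n : ℕ) (μ : ℕ → ℕ) : MvPolynomial (Fin n) ℤ :=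
  ∑ g ∈ patterns n μ, ∏ i : Fin n, X i ^ weight n g i

open MvPolynomial in
/-- The alternant `det (X_i ^ v_j)`. -/
noncomputable def alternant (n : ℕ) (v : ℕ → ℕ) : MvPolynomial (Fin n) ℤ :=
  (Matrix.of fun i j : Fin n => (X i : MvPolynomial (Fin n) ℤ) ^ v j).det

/-- The staircase `(n - 1, n - 2, …, 0)`. -/
def staircase (n i : ℕ) : ℕ := n - 1 - i

lemma swap_of_ne_of_val_ne {n k : ℕ} (hk : k + 1 < n) {i : Fin n} (h₀ : (i : ℕ) ≠ k)
    (h₁ : (i : ℕ) ≠ k + 1) : Equiv.swap (⟨k, by omega⟩ : Fin n) ⟨k + 1, hk⟩ i = i :=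
  Equiv.swap_apply_of_ne_of_ne (by simpa [Fin.ext_iff] using h₀) (by simpa [Fin.ext_iff] using h₁)

lemma swap_invariant {n k : ℕ} (hk : k + 1 < n) {v w : ℕ → ℕ} (h₀ : w k = v (k + 1))
    (h₁ : w (k + 1) = v k) (h : ∀ i, i ≠ k → i ≠ k + 1 → w i = v i) (i : Fin n) :
    w i = v (Equiv.swap (⟨k, by omega⟩ : Fin n) ⟨k + 1, hk⟩ i : Fin n) := by
  by_cases hi : (i : ℕ) = k
  · rw [show i = ⟨k, by omega⟩ from Fin.ext hi]
    simpa using h₀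
  by_cases hi' : (i : ℕ) = k + 1
  · rw [show i = ⟨k + 1, hk⟩ from Fin.ext hi']
    simpa using h₁
  rw [swap_of_ne_of_val_ne hk hi hi', h i hi hi']

lemma weight_toggle_of_ne (n : ℕ) (g : ℕ → ℕ → ℕ) {k l : ℕ} (m e : ℕ) (h₀ : l ≠ k)
    (h₁ : l ≠ k + 1) : weight n (toggle g k m e) l = weight n g l := by
  rw [weight, weight, rowSum_toggle_of_ne g m e n (by omega), rowSum_toggle_of_ne g m e n h₁]

open MvPolynomial in
lemma rename_swap_schur (n : ℕ) (μ : ℕ → ℕ) {k : ℕ} (hk : k + 1 < n) :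
    rename (Equiv.swap (⟨k, by omega⟩ : Fin n) ⟨k + 1, hk⟩) (schur n μ) = schur n μ := by
  have htog : ∀ g, IsGT n μ g → Togglable g k 0 0 := fun g hg =>
    ⟨by simpa using hg.le_succ (k + 1) 0, by simp⟩
  simp only [schur, map_sum, map_prod, map_pow, rename_X]
  refine sum_nbij' (fun g => toggle g k 0 0) (fun g => toggle g k 0 0) ?_ ?_ ?_ ?_ ?_
  · intro g hg
    rw [mem_patterns] at *
    exact hg.toggle (htog g hg) hk
  · intro g hg
    rw [mem_patterns] at *
    exact hg.toggle (htog g hg) hk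
  · intro g hg
    rw [mem_patterns] at *
    exact hg.toggle_toggle (htog g hg)
  · intro g hg
    rw [mem_patterns] at *
    exact hg.toggle_toggle (htog g hg)
  · intro g hg
    rw [mem_patterns] at *
    have h' := hg.toggle (htog g hg) hk
    have hs := hg.rowSum_toggle (htog g hg) (by omega) hk
    have a₁ := hg.weight_add k
    have a₂ := hg.weight_add (k + 1)
    have b₁ := h'.weight_add k
    have b₂ := h'.weight_add (k + 1)
    rw [rowSum_toggle_of_ne g (k := k) 0 0 n (by omega)] at b₁
    rw [rowSum_toggle_of_ne g (k := k) (l := k + 1 + 1) 0 0 n (by omega)] at b₂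
    simp only [rowSum_zero] at hs
    have e : k + 1 + 1 = k + 2 := rfl
    rw [e] at *
    refine Fintype.prod_equiv (Equiv.swap (⟨k, by omega⟩ : Fin n) ⟨k + 1, hk⟩) _ _ fun i => ?_
    rw [← swap_invariant hk (v := weight n (toggle g k 0 0)) (w := weight n g)
      (by omega) (by omega) fun i h₀ h₁ => (weight_toggle_of_ne n g 0 0 h₀ h₁).symm]

open MvPolynomial in
lemma isSymmetric_schur (n : ℕ) (μ : ℕ → ℕ) : (schur n μ).IsSymmetric := by
  intro σ
  rcases n with _ | n
  · rw [Subsingleton.elim σ (Equiv.refl _)]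
    simp
  · have hσ : σ ∈ Submonoid.closure
        (Set.range fun i : Fin n => Equiv.swap i.castSucc i.succ) := by
      rw [Equiv.Perm.mclosure_swap_castSucc_succ]
      trivial
    induction hσ using Submonoid.closure_induction with
    | mem σ h =>
      obtain ⟨i, rfl⟩ := h
      exact rename_swap_schur (n + 1) μ (k := i) (by omega)
    | one => simp
    | mul σ τ _ _ h₁ h₂ =>
      rw [Equiv.Perm.coe_mul, ← rename_rename, h₂, h₁]

open MvPolynomial in
lemma alternant_mul_schur (n : ℕ) (v μ : ℕ → ℕ) :
    alternant n v * schur n μ = ∑ t ∈ patterns n μ, alternant n (v + weight n t) := by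
  simp only [alternant, Matrix.det_apply, Matrix.of_apply]
  rw [sum_comm, sum_mul]
  refine sum_congr rfl fun σ _ => ?_
  rw [smul_mul_assoc, ← smul_sum, ← isSymmetric_schur n μ σ]
  simp only [schur, map_sum, map_prod, map_pow, rename_X, mul_sum, ← prod_mul_distrib,
    Pi.add_apply, pow_add]

lemma alternant_swap (n : ℕ) {k : ℕ} (hk : k + 1 < n) {v w : ℕ → ℕ} (h₀ : w k = v (k + 1))
    (h₁ : w (k + 1) = v k) (h : ∀ i, i ≠ k → i ≠ k + 1 → w i = v i) :
    alternant n w = -alternant n v := by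
  have key := Matrix.det_permute' (Equiv.swap (⟨k, by omega⟩ : Fin n) ⟨k + 1, hk⟩)
    (Matrix.of fun i j : Fin n => (MvPolynomial.X i : MvPolynomial (Fin n) ℤ) ^ v j)
  rw [Equiv.Perm.sign_swap (by simp [Fin.ext_iff])] at key
  simp only [Units.val_neg, Units.val_one, Int.cast_neg, Int.cast_one, neg_mul, one_mul] at key
  rw [alternant, alternant, ← key]
  congr 1
  ext1 i j
  simp only [Matrix.of_apply, Matrix.submatrix_apply, id]
  rw [swap_invariant hk h₀ h₁ h j]

lemma alternant_staircase_ne_zero (n : ℕ) : alternant n (staircase n) ≠ 0 := by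
  have : (Matrix.vandermonde (MvPolynomial.X : Fin n → MvPolynomial (Fin n) ℤ)).det ≠ 0 :=
    Matrix.det_vandermonde_ne_zero_iff.2 (MvPolynomial.X_injective)
  have key := Matrix.det_permute' Fin.revPerm
    (Matrix.vandermonde (MvPolynomial.X : Fin n → MvPolynomial (Fin n) ℤ))
  have e : alternant n (staircase n) =
      ((Matrix.vandermonde (MvPolynomial.X : Fin n → MvPolynomial (Fin n) ℤ)).submatrix id
        Fin.revPerm).det := by
    rw [alternant]
    congr 1
    ext1 i j
    simp only [Matrix.of_apply, Matrix.submatrix_apply, id, Matrix.vandermonde_apply,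
      Fin.revPerm_apply, Fin.val_rev, staircase]
    congr 1
    omega
  rw [e, key]
  refine mul_ne_zero ?_ this
  rcases Int.units_eq_one_or (Equiv.Perm.sign (Fin.revPerm : Equiv.Perm (Fin n))) with h | h <;>
    simp [h]

/-! ### Good patterns and the Littlewood–Richardson rule -/

/-- The pattern `t` violates the lattice condition relative to `α` at its row `m` and the
entries `k`, `k + 1`. -/
def Violation (α : ℕ → ℕ) (t : ℕ → ℕ → ℕ) (m k : ℕ) : Prop :=
  α k + rowSum t (k + 1) m + rowSum t (k + 1) (m + 1) <
    α (k + 1) + rowSum t (k + 2) (m + 1) + rowSum t k m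

/-- The pattern `t` is `α`-good: adding its entries to `α` in the order of its row reading word
yields partitions at every stage. -/
def Good (α : ℕ → ℕ) (t : ℕ → ℕ → ℕ) : Prop := ∀ m k, ¬ Violation α t m k

/-- `(m, k)` is the first violation of `t` in the row reading order. -/
structure FirstViolation (α : ℕ → ℕ) (t : ℕ → ℕ → ℕ) (m k : ℕ) : Prop where
  violation : Violation α t m k
  not_of_lt : ∀ m' < m, ∀ k', ¬ Violation α t m' k'
  not_of_gt : ∀ k' > k, ¬ Violation α t m k'

lemma FirstViolation.unique {α : ℕ → ℕ} {t : ℕ → ℕ → ℕ} {m k m' k' : ℕ}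
    (h : FirstViolation α t m k) (h' : FirstViolation α t m' k') : m = m' ∧ k = k' := by
  obtain rfl : m = m' := by
    rcases lt_trichotomy m m' with hm | hm | hm
    · exact absurd h.violation (h'.not_of_lt m hm k)
    · exact hm
    · exact absurd h'.violation (h.not_of_lt m' hm k')
  refine ⟨rfl, ?_⟩
  rcases lt_trichotomy k k' with hk | hk | hk
  · exact absurd h'.violation (h.not_of_gt k' hk)
  · exact hk
  · exact absurd h.violation (h'.not_of_gt k hk)

section

variable {n : ℕ} {α μ : ℕ → ℕ} {t : ℕ → ℕ → ℕ} {m k : ℕ}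

lemma Violation.lt (h : Violation α t m k) (hα : ∀ i, n ≤ i → α i = 0) (ht : IsGT n μ t) :
    k + 1 < n := by
  by_contra hk
  rw [Violation, hα (k + 1) (by omega), ht.rowSum_top (k := k + 1) (by omega),
    ht.rowSum_top (k := k + 1) (by omega), ht.rowSum_top (k := k + 2) (by omega)] at h
  have := ht.rowSum_le_succ k m
  rw [ht.rowSum_top (k := k + 1) (by omega)] at this
  omega

lemma exists_firstViolation (hα : ∀ i, n ≤ i → α i = 0) (ht : IsGT n μ t) (hg : ¬ Good α t) :
    ∃ m k, FirstViolation α t m k := by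
  simp only [Good, not_forall, not_not] at hg
  have hm := Nat.find_spec hg
  refine ⟨Nat.find hg, Nat.findGreatest (Violation α t (Nat.find hg)) n, ?_, ?_, ?_⟩
  · obtain ⟨k, hk⟩ := hm
    exact Nat.findGreatest_spec (by have := hk.lt hα ht; omega) hk
  · intro m' hm' k' hk'
    exact Nat.find_min hg hm' ⟨k', hk'⟩
  · intro k' hk' h
    have := h.lt hα ht
    exact Nat.findGreatest_is_greatest hk' (by omega) h

/-- The number of cells of row `m` cut off by the violation `(m, k)`. -/
def excess (α : ℕ → ℕ) (t : ℕ → ℕ → ℕ) (m k : ℕ) : ℕ :=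
  α k + 1 + 2 * rowSum t (k + 1) m - (α (k + 1) + rowSum t k m + rowSum t (k + 2) m)

namespace FirstViolation

lemma excess_spec (hv : FirstViolation α t m k) (hα : Antitone α) (ht : IsGT n μ t) :
    excess α t m k + (α (k + 1) + rowSum t k m + rowSum t (k + 2) m) =
        α k + 1 + 2 * rowSum t (k + 1) m ∧
      0 < excess α t m k ∧ Togglable t k m (excess α t m k) := by
  have hα : α (k + 1) ≤ α k := hα (Nat.le_succ k)
  have h₁ := hv.violation
  simp only [Violation, rowSum_succ] at h₁
  have h₂ : t (k + 1) m ≤ t (k + 2) m := ht.le_succ (k + 1) m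
  simp only [Togglable, excess]
  rcases m with _ | m
  · simp only [rowSum_zero] at *
    refine ⟨by omega, by omega, by omega, by omega⟩
  · have h₃ := hv.not_of_lt m (by omega) k
    simp only [Violation, rowSum_succ] at h₃ h₁ ⊢
    have h₄ : t (k + 2) (m + 1) ≤ t (k + 1) m := ht.succ_le (k + 1) m
    have h₅ := ht.le_succ k m
    refine ⟨by omega, by omega, by omega, ?_⟩
    rintro i hi
    obtain rfl : m = i := by omega
    omega

lemma violation_toggle_iff {m' k' e : ℕ} (h : m' < m ∨ (m' = m ∧ k < k')) :
    Violation α (toggle t k m e) m' k' ↔ Violation α t m' k' := by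
  rw [Violation, Violation]
  rcases h with h | ⟨rfl, h⟩
  · simp only [rowSum_toggle_of_le t h.le, rowSum_toggle_of_le t (Nat.succ_le_of_lt h)]
  · rw [rowSum_toggle_of_le t le_rfl, rowSum_toggle_of_le t le_rfl,
      rowSum_toggle_of_ne t (l := k' + 2) _ _ _ (by omega), rowSum_succ, rowSum_succ,
      rowSum_toggle_of_le t le_rfl]
    by_cases hk : k' = k
    · omega
    · rw [toggle_of_ne t m' e (by omega), rowSum_succ]

lemma toggle (hv : FirstViolation α t m k) (hα : Antitone α) (ht : IsGT n μ t) :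
    FirstViolation α (toggle t k m (excess α t m k)) m k := by
  obtain ⟨h₁, h₂, h₃⟩ := hv.excess_spec hα ht
  refine ⟨?_, fun m' hm' k' => ?_, fun k' hk' => ?_⟩
  · have a₁ := ht.le_succ k m
    have a₃ : t (k + 2) (m + 1) ≤ t (k + 1) m := ht.succ_le (k + 1) m
    have := h₃.1
    simp only [Violation, rowSum_succ, rowSum_toggle_of_le t le_rfl, toggle_self, toggleRow,
      lt_irrefl, if_false, if_true]
    rw [toggle_of_ne t (l := k + 2) _ _ (by omega)]
    generalize excess α t m k = e at *
    omega
  · rw [violation_toggle_iff (Or.inl hm')]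
    exact hv.not_of_lt m' hm' k'
  · rw [violation_toggle_iff (Or.inr ⟨rfl, hk'⟩)]
    exact hv.not_of_gt k' hk'

lemma excess_toggle (m k e : ℕ) : excess α (LittlewoodRichardson.toggle t k m e) m k =
    excess α t m k := by
  simp only [excess, rowSum_toggle_of_le t le_rfl]

lemma row_lt (hv : FirstViolation α t m k) (hα : Antitone α) (ht : IsGT n μ t) : m < n := by
  obtain ⟨-, h₂, h₃, -⟩ := hv.excess_spec hα ht
  by_contra hm
  have := ht.le_top (k + 2) m
  rw [ht.top_eq_zero (by omega)] at this
  omega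

lemma alternant_toggle (hv : FirstViolation α t m k) (hα : Antitone α)
    (hα₀ : ∀ i, n ≤ i → α i = 0) (ht : IsGT n μ t) :
    alternant n (α + staircase n +
        weight n (LittlewoodRichardson.toggle t k m (excess α t m k))) =
      -alternant n (α + staircase n + weight n t) := by
  obtain ⟨h₁, h₂, h₃⟩ := hv.excess_spec hα ht
  have hk := hv.violation.lt hα₀ ht
  have hs := ht.rowSum_toggle h₃ (hv.row_lt hα ht) hk
  have h' := ht.toggle h₃ hk
  generalize excess α t m k = e at *
  have a₁ := ht.weight_add k
  have a₂ : weight n t (k + 1) + rowSum t (k + 1) n = rowSum t (k + 2) n := ht.weight_add (k + 1)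
  have b₁ := h'.weight_add k
  have b₂ : _ + _ = rowSum _ (k + 2) n := h'.weight_add (k + 1)
  rw [rowSum_toggle_of_ne t (k := k) _ _ n (by omega)] at b₁
  rw [rowSum_toggle_of_ne t (k := k) (l := k + 2) _ _ n (by omega)] at b₂
  refine alternant_swap n hk ?_ ?_ fun i h₀ h₁ => ?_
  · simp only [Pi.add_apply, staircase]
    omega
  · simp only [Pi.add_apply, staircase]
    omega
  · simp only [Pi.add_apply, weight_toggle_of_ne n t _ _ h₀ h₁]

end FirstViolation

lemma alternant_mul_schur_eq_sum_good (hα : Antitone α) (hα₀ : ∀ i, n ≤ i → α i = 0) :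
    alternant n (α + staircase n) * schur n μ =
      ∑ t ∈ patterns n μ with Good α t, alternant n (α + staircase n + weight n t) := by
  rw [alternant_mul_schur, ← sum_filter_add_sum_filter_not _ (Good α), add_eq_left]
  have hex : ∀ t ∈ {t ∈ patterns n μ | ¬ Good α t}, ∃ mk : ℕ × ℕ, FirstViolation α t mk.1 mk.2 := by
    intro t ht
    rw [mem_filter, mem_patterns] at ht
    obtain ⟨m, k, h⟩ := exists_firstViolation hα₀ ht.1 ht.2
    exact ⟨(m, k), h⟩
  choose! f hf using hex
  have hmem : ∀ t ∈ {t ∈ patterns n μ | ¬ Good α t},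
      toggle t (f t).2 (f t).1 (excess α t (f t).1 (f t).2) ∈
        {t ∈ patterns n μ | ¬ Good α t} := by
    intro t ht
    have hv := hf t ht
    rw [mem_filter, mem_patterns] at ht ⊢
    exact ⟨ht.1.toggle (hv.excess_spec hα ht.1).2.2 (hv.violation.lt hα₀ ht.1),
      fun h => h _ _ (hv.toggle hα ht.1).violation⟩
  refine sum_involution (fun t _ => toggle t (f t).2 (f t).1 (excess α t (f t).1 (f t).2))
    ?_ ?_ hmem ?_
  · intro t ht
    have hv := hf t ht
    rw [mem_filter, mem_patterns] at ht
    rw [hv.alternant_toggle hα hα₀ ht.1, add_neg_cancel]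
  · intro t ht h₀ h
    have hv := hf t ht
    rw [mem_filter, mem_patterns] at ht
    have := hv.alternant_toggle hα hα₀ ht.1
    rw [h] at this
    exact h₀ (self_eq_neg.1 this)
  · intro t ht
    have hv := hf t ht
    have hv' := hf _ (hmem t ht)
    rw [mem_filter, mem_patterns] at ht
    obtain ⟨h₁, h₂⟩ := hv'.unique (hv.toggle hα ht.1)
    simp only [h₁, h₂, FirstViolation.excess_toggle]
    exact ht.1.toggle_toggle (hv.excess_spec hα ht.1).2.2

end

/-- The pattern of the tableau of shape `μ` all of whose entries in row `i` are `i`. -/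
def superstandard (μ : ℕ → ℕ) (k i : ℕ) : ℕ := if i < k then μ i else 0

lemma isGT_superstandard {n : ℕ} {μ : ℕ → ℕ} (hμ : Antitone μ) (hμ₀ : ∀ i, n ≤ i → μ i = 0) :
    IsGT n μ (superstandard μ) := by
  refine ⟨fun i => by simp [superstandard], fun k hk i => ?_, fun k i => ?_, fun k i => ?_⟩
  · rw [superstandard]
    split_ifs with h
    · rfl
    · exact (hμ₀ i (by omega)).symm
  · simp only [superstandard]
    split_ifs <;> omega
  · have : μ (i + 1) ≤ μ i := hμ (Nat.le_succ i)
    simp only [superstandard]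
    split_ifs <;> omega

lemma rowSum_superstandard_succ (μ : ℕ → ℕ) (k m : ℕ) :
    rowSum (superstandard μ) (k + 1) m =
      rowSum (superstandard μ) k m + if k < m then μ k else 0 := by
  induction m with
  | zero => simp [rowSum_zero]
  | succ m ih =>
    rw [rowSum_succ, rowSum_succ, ih]
    simp only [superstandard]
    rcases lt_trichotomy k m with h | h | h
    · rw [if_pos h, if_neg (by omega), if_neg (by omega), if_pos (by omega)]
      omega
    · subst h
      simp
    · rw [if_neg (by omega), if_pos (by omega), if_pos h, if_neg (by omega)]
      omega

lemma good_superstandard {μ : ℕ → ℕ} (hμ : Antitone μ) : Good 0 (superstandard μ) := by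
  intro m k
  have : μ (k + 1) ≤ μ k := hμ (Nat.le_succ k)
  simp only [Violation, Pi.zero_apply, rowSum_succ, rowSum_superstandard_succ μ (k + 1) m,
    rowSum_superstandard_succ μ k m, superstandard]
  by_cases h : m = k + 1
  · subst h
    split_ifs <;> omega
  · split_ifs <;> omega

lemma weight_superstandard {n : ℕ} {μ : ℕ → ℕ} (hμ₀ : ∀ i, n ≤ i → μ i = 0) :
    weight n (superstandard μ) = μ := by
  funext k
  rw [weight, rowSum_superstandard_succ, Nat.add_sub_cancel_left]
  split_ifs with h
  · rfl
  · exact (hμ₀ k (by omega)).symm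

lemma eq_superstandard_of_good {n : ℕ} {μ : ℕ → ℕ} {t : ℕ → ℕ → ℕ} (ht : IsGT n μ t)
    (hg : Good 0 t) : t = superstandard μ := by
  have hS : ∀ k m, m ≤ k → rowSum t (k + 1) m = rowSum t k m := by
    intro k
    induction k with
    | zero =>
      intro m hm
      obtain rfl : m = 0 := by omega
      rfl
    | succ k ih =>
      rintro (_ | m) hm
      · rfl
      · have h₁ := hg m k
        have h₂ := ih m (by omega)
        have h₃ := ht.rowSum_le_succ (k + 1) (m + 1)
        simp only [Violation, Pi.zero_apply] at h₁
        have e : k + 1 + 1 = k + 2 := rfl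
        rw [e] at *
        omega
  have hstep : ∀ k m, m < k → t (k + 1) m = t k m := by
    intro k m hm
    have h₁ := hS k m hm.le
    have h₂ := hS k (m + 1) hm
    simp only [rowSum_succ] at h₂
    omega
  have hadd : ∀ d k m, m < k → t (k + d) m = t k m := by
    intro d k m hm
    induction d with
    | zero => rfl
    | succ d ih => rw [← add_assoc, hstep _ _ (by omega), ih]
  funext k m
  rw [superstandard]
  split_ifs with h
  · rw [← hadd n k m h, ht.top _ (by omega)]
  · exact ht.eq_zero (by omega)

lemma alternant_staircase_mul_schur {n : ℕ} {μ : ℕ → ℕ} (hμ : Antitone μ)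
    (hμ₀ : ∀ i, n ≤ i → μ i = 0) :
    alternant n (staircase n) * schur n μ = alternant n (μ + staircase n) := by
  have h := alternant_mul_schur_eq_sum_good (n := n) (α := 0) (μ := μ) (fun _ _ _ => le_rfl)
    (fun _ _ => rfl)
  have hs : {t ∈ patterns n μ | Good 0 t} = {superstandard μ} := by
    ext t
    rw [mem_filter, mem_patterns, mem_singleton]
    refine ⟨fun h => eq_superstandard_of_good h.1 h.2, ?_⟩
    rintro rfl
    exact ⟨isGT_superstandard hμ hμ₀, good_superstandard hμ⟩
  rw [hs, sum_singleton, weight_superstandard hμ₀, zero_add, add_comm] at h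
  exact h

lemma Good.antitone_add_weight {n : ℕ} {α μ : ℕ → ℕ} {t : ℕ → ℕ → ℕ} (ht : IsGT n μ t)
    (hg : Good α t) : Antitone (α + weight n t) := by
  refine antitone_nat_of_succ_le fun k => ?_
  have h := hg n k
  have h₁ : weight n t (k + 1) + rowSum t (k + 1) n = rowSum t (k + 2) n := ht.weight_add (k + 1)
  have h₂ := ht.weight_add k
  have h₃ : ∀ l, t l n = 0 := fun l => by
    have := ht.le_top l n
    rw [ht.top_eq_zero le_rfl] at this
    omega
  simp only [Violation, rowSum_succ, h₃] at h
  simp only [Pi.add_apply]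
  omega

/-- The Littlewood–Richardson rule for Schur polynomials. -/
theorem schur_mul_schur {n : ℕ} {α : ℕ → ℕ} (hα : Antitone α) (hα₀ : ∀ i, n ≤ i → α i = 0)
    (β : ℕ → ℕ) :
    schur n α * schur n β = ∑ t ∈ patterns n β with Good α t, schur n (α + weight n t) := by
  refine mul_left_cancel₀ (alternant_staircase_ne_zero n) ?_
  rw [← mul_assoc, alternant_staircase_mul_schur hα hα₀, alternant_mul_schur_eq_sum_good hα hα₀,
    mul_sum]
  refine sum_congr rfl fun t ht => ?_
  rw [mem_filter, mem_patterns] at ht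
  rw [alternant_staircase_mul_schur (ht.2.antitone_add_weight ht.1), add_right_comm]
  intro i hi
  rw [Pi.add_apply, hα₀ i hi, ht.1.weight_eq_zero hi]

open MvPolynomial in
lemma coeff_prod_X_pow {n : ℕ} (v : Fin n → ℕ) (c : ℕ → ℕ) :
    coeff (Finsupp.equivFunOnFinite.symm fun i : Fin n => c i)
      (∏ i : Fin n, X i ^ v i : MvPolynomial (Fin n) ℤ) = if ∀ i, v i = c i then 1 else 0 := by
  have : (∏ i : Fin n, X i ^ v i : MvPolynomial (Fin n) ℤ) =
      monomial (Finsupp.equivFunOnFinite.symm v) 1 := by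
    rw [monomial_eq, Finsupp.prod_fintype _ _ (by simp)]
    simp
  rw [this, coeff_monomial]
  refine if_congr ?_ rfl rfl
  rw [EmbeddingLike.apply_eq_iff_eq, funext_iff]

lemma coeff_schur (n : ℕ) (μ c : ℕ → ℕ) :
    (schur n μ).coeff (Finsupp.equivFunOnFinite.symm fun i : Fin n => c i) =
      #{g ∈ patterns n μ | ∀ i : Fin n, weight n g i = c i} := by
  rw [schur, MvPolynomial.coeff_sum, card_filter, Nat.cast_sum]
  refine sum_congr rfl fun g _ => ?_
  rw [coeff_prod_X_pow]
  simp

lemma coeff_schur_mul_schur (n : ℕ) (α β c : ℕ → ℕ) :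
    (schur n α * schur n β).coeff (Finsupp.equivFunOnFinite.symm fun i : Fin n => c i) =
      #{p ∈ patterns n α ×ˢ patterns n β |
        ∀ i : Fin n, weight n p.1 i + weight n p.2 i = c i} := by
  rw [schur, schur, sum_mul_sum, ← sum_product', MvPolynomial.coeff_sum, card_filter,
    Nat.cast_sum]
  refine sum_congr rfl fun g _ => ?_
  simp only [← prod_mul_distrib, ← pow_add]
  rw [coeff_prod_X_pow]
  simp

/-- Pairs of patterns of shapes `α` and `β` with total content `c`. -/
def PatternPairs (n : ℕ) (α β c : ℕ → ℕ) : Type :=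
  {p : (ℕ → ℕ → ℕ) × (ℕ → ℕ → ℕ) //
    IsGT n α p.1 ∧ IsGT n β p.2 ∧ ∀ k, weight n p.1 k + weight n p.2 k = c k}

/-- Pairs of an `α`-good pattern `t` of shape `β` and a pattern of shape `α + weight t` with
content `c`. -/
def GoodPairs (n : ℕ) (α β c : ℕ → ℕ) : Type :=
  {p : (ℕ → ℕ → ℕ) × (ℕ → ℕ → ℕ) //
    IsGT n β p.1 ∧ Good α p.1 ∧ IsGT n (α + weight n p.1) p.2 ∧ ∀ k, weight n p.2 k = c k}

lemma forall_fin_iff {n : ℕ} {v c : ℕ → ℕ} (hv : ∀ k, n ≤ k → v k = 0)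
    (hc : ∀ k, n ≤ k → c k = 0) : (∀ i : Fin n, v i = c i) ↔ ∀ k, v k = c k := by
  refine ⟨fun h k => ?_, fun h i => h i⟩
  by_cases hk : k < n
  · exact h ⟨k, hk⟩
  · rw [hv k (by omega), hc k (by omega)]

lemma nonempty_patternPairs_equiv_goodPairs {n : ℕ} {α c : ℕ → ℕ} (hα : Antitone α)
    (hα₀ : ∀ i, n ≤ i → α i = 0) (hc : ∀ k, n ≤ k → c k = 0) (β : ℕ → ℕ) :
    Nonempty (PatternPairs n α β c ≃ GoodPairs n α β c) := by
  let s := {p ∈ patterns n α ×ˢ patterns n β |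
    ∀ i : Fin n, weight n p.1 i + weight n p.2 i = c i}
  let s' := ({t ∈ patterns n β | Good α t}).sigma fun t =>
    {g ∈ patterns n (α + weight n t) | ∀ i : Fin n, weight n g i = c i}
  have hcard : s.card = s'.card := by
    have h := congrArg
      (MvPolynomial.coeff (Finsupp.equivFunOnFinite.symm fun i : Fin n => c i))
      (schur_mul_schur hα hα₀ β)
    rw [coeff_schur_mul_schur, MvPolynomial.coeff_sum] at h
    simp only [coeff_schur] at h
    rw [card_sigma]
    exact_mod_cast h
  have e : PatternPairs n α β c ≃ s := Equiv.subtypeEquivRight fun p => by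
    simp only [s, mem_filter, mem_product, mem_patterns, and_assoc]
    refine and_congr_right fun h₁ => and_congr_right fun h₂ => (forall_fin_iff ?_ hc).symm
    intro k hk
    rw [h₁.weight_eq_zero hk, h₂.weight_eq_zero hk]
  have e' : GoodPairs n α β c ≃ s' :=
    (Equiv.sigmaEquivProd (ℕ → ℕ → ℕ) (ℕ → ℕ → ℕ)).symm.subtypeEquiv fun p => by
      simp only [s', mem_sigma, mem_filter, mem_patterns, and_assoc]
      refine and_congr_right fun h₁ => and_congr_right fun h₂ => and_congr_right fun h₃ =>
        (forall_fin_iff ?_ hc).symm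
      intro k hk
      exact h₃.weight_eq_zero hk
  exact ⟨e.trans ((Finset.equivOfCardEq hcard).trans e'.symm)⟩

/-! ### Row-monotone fillings of skew shapes and their cut functions -/

/-- `T` is a filling of the shape `a/b` (zero outside) with weakly increasing rows. -/
structure RowFill (a b : ℕ → ℕ) (T : ℕ → ℕ → ℕ) : Prop where
  zero : ∀ i j, ¬ (b i ≤ j ∧ j < a i) → T i j = 0
  mono : ∀ i j₁ j₂, b i ≤ j₁ → j₁ ≤ j₂ → j₂ < a i → T i j₁ ≤ T i j₂

/-- The number of entries `k` in row `i`. -/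
def rowCount (a b : ℕ → ℕ) (T : ℕ → ℕ → ℕ) (k i : ℕ) : ℕ := #{j ∈ Ico (b i) (a i) | T i j = k}

/-- The end of the `i`-th row of the shape formed by `b` and the entries smaller than `k`. -/
def cut (a b : ℕ → ℕ) (T : ℕ → ℕ → ℕ) (k i : ℕ) : ℕ := b i + #{j ∈ Ico (b i) (a i) | T i j < k}

/-- `C` is the cut function of a filling of `a/b` with entries below `n`. -/
structure IsCut (n : ℕ) (a b : ℕ → ℕ) (C : ℕ → ℕ → ℕ) : Prop where
  zero : ∀ i, C 0 i = b i
  top : ∀ k, n ≤ k → ∀ i, C k i = a i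
  le_succ : ∀ k i, C k i ≤ C (k + 1) i

/-- The filling of `a/b` with cut function `C`. -/
noncomputable def fill (a b : ℕ → ℕ) (C : ℕ → ℕ → ℕ) (i j : ℕ) : ℕ :=
  if b i ≤ j ∧ j < a i then sInf {k | j < C (k + 1) i} else 0

section

variable {n : ℕ} {a b : ℕ → ℕ} {T T' : ℕ → ℕ → ℕ} {C : ℕ → ℕ → ℕ}

lemma cut_zero (a b : ℕ → ℕ) (T : ℕ → ℕ → ℕ) (i : ℕ) : cut a b T 0 i = b i := by simp [cut]

lemma cut_succ (a b : ℕ → ℕ) (T : ℕ → ℕ → ℕ) (k i : ℕ) :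
    cut a b T (k + 1) i = cut a b T k i + rowCount a b T k i := by
  rw [cut, cut, rowCount, add_assoc, ← card_union_of_disjoint]
  · congr 2
    ext j
    rw [mem_union, mem_filter, mem_filter, mem_filter, Nat.lt_succ_iff_lt_or_eq, and_or_left]
  · rw [disjoint_filter]
    exact fun j _ hj => Nat.ne_of_lt hj

lemma le_cut (a b : ℕ → ℕ) (T : ℕ → ℕ → ℕ) (k i : ℕ) : b i ≤ cut a b T k i := Nat.le_add_right _ _

lemma cut_le (hab : b ≤ a) (T : ℕ → ℕ → ℕ) (k i : ℕ) : cut a b T k i ≤ a i := by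
  have h := card_filter_le (Ico (b i) (a i)) (T i · < k)
  have hab' : b i ≤ a i := hab i
  rw [Nat.card_Ico] at h
  rw [cut]
  omega

lemma cut_eq_of_forall_lt (hab : b ≤ a) {k i : ℕ} (h : ∀ j, b i ≤ j → j < a i → T i j < k) :
    cut a b T k i = a i := by
  rw [cut, filter_true_of_mem, Nat.card_Ico, Nat.add_sub_cancel' (hab i)]
  intro j hj
  rw [mem_Ico] at hj
  exact h j hj.1 hj.2

lemma RowFill.lt_cut_iff (h : RowFill a b T) {k i j : ℕ} (hb : b i ≤ j) (ha : j < a i) :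
    j < cut a b T k i ↔ T i j < k := by
  constructor
  · intro hj
    by_contra hT
    have hsub : {j ∈ Ico (b i) (a i) | T i j < k} ⊆ Ico (b i) j := by
      intro j' hj'
      simp only [mem_filter, mem_Ico] at hj' ⊢
      refine ⟨hj'.1.1, ?_⟩
      by_contra hlt
      have := h.mono i j j' hb (by omega) hj'.1.2
      omega
    have := card_le_card hsub
    rw [Nat.card_Ico] at this
    rw [cut] at hj
    omega
  · intro hT
    have hsub : Ico (b i) (j + 1) ⊆ {j ∈ Ico (b i) (a i) | T i j < k} := by
      intro j' hj'
      simp only [mem_filter, mem_Ico] at hj' ⊢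
      have := h.mono i j' j hj'.1 (by omega) ha
      omega
    have := card_le_card hsub
    rw [Nat.card_Ico] at this
    rw [cut]
    omega

lemma RowFill.ext_cut (h : RowFill a b T) (h' : RowFill a b T')
    (hcut : cut a b T = cut a b T') : T = T' := by
  funext i j
  by_cases hj : b i ≤ j ∧ j < a i
  · have key : ∀ k, T i j < k ↔ T' i j < k := fun k => by
      rw [← h.lt_cut_iff hj.1 hj.2, ← h'.lt_cut_iff hj.1 hj.2, hcut]
    have h₁ := (key (T i j + 1)).1 (Nat.lt_succ_self _)
    have h₂ := (key (T' i j + 1)).2 (Nat.lt_succ_self _)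
    omega
  · rw [h.zero i j hj, h'.zero i j hj]

namespace IsCut

lemma monotone (h : IsCut n a b C) (i : ℕ) : Monotone (C · i) :=
  monotone_nat_of_le_succ fun k => h.le_succ k i

lemma le_base (h : IsCut n a b C) (k i : ℕ) : b i ≤ C k i := by
  rw [← h.zero i]
  exact h.monotone i (Nat.zero_le k)

lemma le_top (h : IsCut n a b C) (k i : ℕ) : C k i ≤ a i := by
  rw [← h.top (max k n) (le_max_right _ _) i]
  exact h.monotone i (le_max_left _ _)

lemma fill_lt_iff (h : IsCut n a b C) {k i j : ℕ} (hb : b i ≤ j) (ha : j < a i) :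
    fill a b C i j < k ↔ j < C k i := by
  have hne : {k | j < C (k + 1) i}.Nonempty := ⟨n, by
    rw [Set.mem_ofPred_eq, h.top _ (by omega)]
    exact ha⟩
  rw [fill, if_pos ⟨hb, ha⟩]
  constructor
  · intro hk
    have h₁ : j < C (sInf {k | j < C (k + 1) i} + 1) i := Nat.sInf_mem hne
    exact h₁.trans_le (h.monotone i hk)
  · intro hk
    rcases k with _ | k
    · rw [h.zero] at hk
      omega
    · exact Nat.lt_succ_of_le (Nat.sInf_le hk)

lemma rowFill_fill (h : IsCut n a b C) : RowFill a b (fill a b C) := by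
  refine ⟨fun i j hj => by rw [fill, if_neg hj], fun i j₁ j₂ h₁ h₁₂ h₂ => ?_⟩
  rw [← Nat.lt_succ_iff, h.fill_lt_iff h₁ (by omega)]
  exact h₁₂.trans_lt ((h.fill_lt_iff (h₁.trans h₁₂) h₂).1 (Nat.lt_succ_self _))

lemma cut_fill (h : IsCut n a b C) : cut a b (fill a b C) = C := by
  have hab : b ≤ a := fun i => (h.le_base 0 i).trans (h.le_top 0 i)
  funext k i
  have key : ∀ j, b i ≤ j → j < a i → (j < cut a b (fill a b C) k i ↔ j < C k i) :=
    fun j hb ha => by rw [h.rowFill_fill.lt_cut_iff hb ha, h.fill_lt_iff hb ha]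
  have h₁ := le_cut a b (fill a b C) k i
  have h₂ := cut_le hab (fill a b C) k i
  have h₃ := h.le_base k i
  have h₄ := h.le_top k i
  rcases lt_trichotomy (cut a b (fill a b C) k i) (C k i) with hlt | heq | hlt
  · have := (key _ h₁ (by omega)).2 hlt
    omega
  · exact heq
  · have := (key _ h₃ (by omega)).1 hlt
    omega

end IsCut

lemma RowFill.column_strict_iff (h : RowFill a b T) (ha : Antitone a) (hb : Antitone b)
    (hab : b ≤ a) :
    (∀ i₁ i₂ j, i₁ < i₂ → b i₁ ≤ j → j < a i₁ → b i₂ ≤ j → j < a i₂ → T i₁ j < T i₂ j) ↔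
      ∀ k i, cut a b T (k + 1) (i + 1) ≤ cut a b T k i := by
  constructor
  · intro hcol k i
    by_contra! hlt
    have h₁ := le_cut a b T k i
    have h₂ := cut_le hab T (k + 1) (i + 1)
    have h₃ : a (i + 1) ≤ a i := ha (Nat.le_succ i)
    have h₄ : b (i + 1) ≤ b i := hb (Nat.le_succ i)
    have h₅ := hcol i (i + 1) (cut a b T k i) (by omega) h₁ (by omega) (by omega) (by omega)
    have h₆ := (h.lt_cut_iff (i := i + 1) (by omega) (by omega)).1 hlt
    have h₇ := (h.lt_cut_iff (k := k) h₁ (by omega)).2 (by omega)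
    omega
  · intro hcut i₁ i₂ j hi
    induction i₂, hi using Nat.le_induction with
    | base =>
      intro hb₁ ha₁ hb₂ ha₂
      rw [← h.lt_cut_iff hb₁ ha₁]
      exact ((h.lt_cut_iff hb₂ ha₂).2 (Nat.lt_succ_self _)).trans_le (hcut _ _)
    | succ i₂ hi ih =>
      intro hb₁ ha₁ hb₂ ha₂
      have hb' : b i₂ ≤ j := (hb (by omega : i₁ ≤ i₂)).trans hb₁
      have ha' : j < a i₂ := ha₂.trans_le (ha (Nat.le_succ i₂))
      refine (ih hb₁ ha₁ hb' ha').trans ?_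
      rw [← h.lt_cut_iff hb' ha']
      exact ((h.lt_cut_iff hb₂ ha₂).2 (Nat.lt_succ_self _)).trans_le (hcut _ _)

lemma isSSYT_iff (ha : Antitone a) : IsSSYT a T ↔ RowFill a (fun _ => 0) T ∧
    ∀ k i, cut a (fun _ => 0) T (k + 1) (i + 1) ≤ cut a (fun _ => 0) T k i := by
  constructor
  · rintro ⟨h₁, h₂, h₃⟩
    have h : RowFill a (fun _ => 0) T :=
      ⟨fun i j hj => h₁ i j (by simpa using hj), fun i j₁ j₂ _ => h₂ i j₁ j₂⟩
    exact ⟨h, (h.column_strict_iff ha (fun _ _ _ => le_rfl) fun i => Nat.zero_le _).1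
      fun i₁ i₂ j hi _ _ _ hj => h₃ i₁ i₂ j hi hj⟩
  · rintro ⟨h, hcut⟩
    refine ⟨fun i j hj => h.zero i j (by simpa using hj),
      fun i j₁ j₂ => h.mono i j₁ j₂ (Nat.zero_le _), fun i₁ i₂ j hi hj => ?_⟩
    exact (h.column_strict_iff ha (fun _ _ _ => le_rfl) fun i => Nat.zero_le _).2 hcut i₁ i₂ j hi
      (Nat.zero_le _) (hj.trans_le (ha hi.le)) (Nat.zero_le _) hj

/-! ### Counting cells -/

lemma card_cells (F : ℕ → Finset ℕ) (N : ℕ) :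
    Nat.card {p : ℕ × ℕ // p.1 < N ∧ p.2 ∈ F p.1} = ∑ i ∈ range N, #(F i) := by
  rw [← card_sigma, ← Fintype.card_coe, ← Nat.card_eq_fintype_card]
  exact Nat.card_congr ((Equiv.sigmaEquivProd ℕ ℕ).symm.subtypeEquiv fun p => by simp)

lemma skewContent_eq {N : ℕ} (hN : ∀ i, N ≤ i → a i ≤ b i) (T : ℕ → ℕ → ℕ) (k : ℕ) :
    skewContent a b T k = ∑ i ∈ range N, rowCount a b T k i := by
  simp only [rowCount]
  rw [← card_cells]
  refine Nat.card_congr (Equiv.subtypeEquivRight fun p => ?_)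
  rw [mem_filter, mem_Ico, and_assoc]
  refine ⟨fun h => ⟨?_, h⟩, fun h => h.2⟩
  by_contra hp
  have := hN p.1 (by omega)
  omega

/-- The number of entries `m` in the first `i` rows; for a Littlewood–Richardson filling this is
the pattern of its companion tableau. -/
def companion (a b : ℕ → ℕ) (T : ℕ → ℕ → ℕ) (i m : ℕ) : ℕ :=
  ∑ i' ∈ range i, rowCount a b T m i'

lemma companion_succ (a b : ℕ → ℕ) (T : ℕ → ℕ → ℕ) (i m : ℕ) :
    companion a b T (i + 1) m = companion a b T i m + rowCount a b T m i :=
  sum_range_succ _ _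

lemma lrCount_eq (a b : ℕ → ℕ) (T : ℕ → ℕ → ℕ) (i j k : ℕ) :
    lrCount a b T i j k =
      companion a b T i k + #{j' ∈ Ico (b i) (a i) | j ≤ j' ∧ T i j' = k} := by
  have h := card_cells
    (fun i' => {j' ∈ Ico (b i') (a i') | (i' = i → j ≤ j') ∧ T i' j' = k}) (i + 1)
  rw [sum_range_succ] at h
  rw [lrCount, companion]
  trans Nat.card {p : ℕ × ℕ // p.1 < i + 1 ∧
    p.2 ∈ {j' ∈ Ico (b p.1) (a p.1) | (p.1 = i → j ≤ j') ∧ T p.1 j' = k}}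
  · refine Nat.card_congr (Equiv.subtypeEquivRight fun p => ?_)
    rw [mem_filter, mem_Ico]
    have : (p.1 < i ∨ p.1 = i ∧ j ≤ p.2) ↔ p.1 < i + 1 ∧ (p.1 = i → j ≤ p.2) := by omega
    rw [this]
    tauto
  · rw [h]
    congr 1
    · refine sum_congr rfl fun i' hi' => ?_
      rw [mem_range] at hi'
      simp [rowCount, hi'.ne]
    · simp

lemma RowFill.lattice_iff (h : RowFill a b T) :
    (∀ i j k, lrCount a b T i j (k + 1) ≤ lrCount a b T i j k) ↔
      ∀ i m, companion a b T (i + 1) (m + 1) ≤ companion a b T i m := by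
  simp only [lrCount_eq, companion_succ]
  constructor
  · intro hl i m
    have h₁ := hl i (cut a b T (m + 1) i) m
    have h₂ : {j' ∈ Ico (b i) (a i) | cut a b T (m + 1) i ≤ j' ∧ T i j' = m + 1} =
        {j' ∈ Ico (b i) (a i) | T i j' = m + 1} := by
      refine filter_congr fun j' hj' => ?_
      rw [mem_Ico] at hj'
      have := h.lt_cut_iff (k := m + 1) hj'.1 hj'.2
      omega
    have h₃ : {j' ∈ Ico (b i) (a i) | cut a b T (m + 1) i ≤ j' ∧ T i j' = m} = ∅ := by
      refine filter_false_of_mem fun j' hj' => ?_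
      rw [mem_Ico] at hj'
      have := h.lt_cut_iff (k := m + 1) hj'.1 hj'.2
      omega
    rw [h₂, h₃, card_empty] at h₁
    exact h₁
  · intro hc i j k
    refine (Nat.add_le_add_left (card_le_card ?_) _).trans ((hc i k).trans (Nat.le_add_right _ _))
    exact monotone_filter_right _ fun _ _ hj => hj.2

lemma isLR_iff (ha : Antitone a) (hb : Antitone b) (hab : b ≤ a) : IsLR a b T ↔
    RowFill a b T ∧ (∀ k i, cut a b T (k + 1) (i + 1) ≤ cut a b T k i) ∧
      ∀ i m, companion a b T (i + 1) (m + 1) ≤ companion a b T i m := by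
  constructor
  · rintro ⟨h₁, h₂, h₃, h₄⟩
    have h : RowFill a b T := ⟨h₁, h₂⟩
    exact ⟨h, (h.column_strict_iff ha hb hab).1 h₃, h.lattice_iff.1 h₄⟩
  · rintro ⟨h, h₃, h₄⟩
    exact ⟨h.zero, h.mono, (h.column_strict_iff ha hb hab).2 h₃, h.lattice_iff.2 h₄⟩

lemma cut_add_rowSum_companion (a b : ℕ → ℕ) (T : ℕ → ℕ → ℕ) (k i : ℕ) :
    cut a b T k i + rowSum (companion a b T) i k =
      b i + rowSum (companion a b T) (i + 1) k := by
  induction k with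
  | zero => simp [cut_zero, rowSum_zero]
  | succ k ih =>
    rw [cut_succ, rowSum_succ, rowSum_succ, companion_succ]
    omega

lemma good_companion_iff : Good b (companion a b T) ↔
    ∀ k i, cut a b T (k + 1) (i + 1) ≤ cut a b T k i := by
  refine forall_congr' fun m => forall_congr' fun k => ?_
  have h₁ := cut_add_rowSum_companion a b T m k
  have h₂ : cut a b T (m + 1) (k + 1) + rowSum (companion a b T) (k + 1) (m + 1) =
      b (k + 1) + rowSum (companion a b T) (k + 2) (m + 1) :=
    cut_add_rowSum_companion a b T (m + 1) (k + 1)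
  rw [Violation]
  omega

/-! ### Littlewood–Richardson fillings and good patterns -/

lemma isGT_companion (ha : Antitone a) (hb : Antitone b) (hab : b ≤ a)
    (ha₀ : ∀ i, n ≤ i → a i = 0) (hT : IsLR a b T) :
    IsGT n (skewContent a b T) (companion a b T) := by
  refine ⟨fun i => rfl, fun k hk i => ?_, fun k i => ?_, ((isLR_iff ha hb hab).1 hT).2.2⟩
  · rw [skewContent_eq (N := k) fun i hi => by rw [ha₀ i (by omega)]; exact Nat.zero_le _]
    rfl
  · rw [companion_succ]
    exact Nat.le_add_right _ _

lemma add_weight_companion (ha : Antitone a) (hb : Antitone b) (hab : b ≤ a)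
    (ha₀ : ∀ i, n ≤ i → a i = 0) (hT : IsLR a b T) : b + weight n (companion a b T) = a := by
  have ht := isGT_companion ha hb hab ha₀ hT
  funext i
  have h₁ : cut a b T n i = a i := by
    refine cut_eq_of_forall_lt hab fun j hbj haj => ?_
    by_contra hj
    have hi : i < n := by
      by_contra hi
      rw [ha₀ i (by omega)] at haj
      omega
    have h₀ := ht.eq_zero (k := i + 1) (i := T i j) (by omega)
    rw [companion_succ, rowCount] at h₀
    have h₂ := card_eq_zero.1 (by omega : #{j' ∈ Ico (b i) (a i) | T i j' = T i j} = 0)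
    have h₃ : j ∈ {j' ∈ Ico (b i) (a i) | T i j' = T i j} := by simp [hbj, haj]
    rw [h₂] at h₃
    simp at h₃
  have h₂ := cut_add_rowSum_companion a b T n i
  have h₃ := ht.weight_add i
  rw [Pi.add_apply]
  omega

lemma RowFill.ext_companion (h : RowFill a b T) (h' : RowFill a b T')
    (hc : companion a b T = companion a b T') : T = T' := by
  refine h.ext_cut h' ?_
  funext k i
  have h₁ := cut_add_rowSum_companion a b T k i
  have h₂ := cut_add_rowSum_companion a b T' k i
  rw [hc] at h₁
  omega

lemma exists_isLR_of_good {α β : ℕ → ℕ} {t : ℕ → ℕ → ℕ} (hα : Antitone α)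
    (ht : IsGT n β t) (hg : Good α t) :
    ∃ T, IsLR (α + weight n t) α T ∧ companion (α + weight n t) α T = t ∧
      skewContent (α + weight n t) α T = β := by
  set γ := α + weight n t with hγ
  have hzero : ∀ l m, n ≤ m → t l m = 0 := fun l m hm => by
    have := ht.le_top l m
    rw [ht.top_eq_zero hm] at this
    omega
  have hsum : ∀ l k, n ≤ k → rowSum t l k = rowSum t l n := fun l k hk => by
    induction k, hk using Nat.le_induction with
    | base => rfl
    | succ k hk ih => rw [rowSum_succ, ih, hzero l k hk, add_zero]
  let C : ℕ → ℕ → ℕ := fun k i => α i + (rowSum t (i + 1) k - rowSum t i k)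
  have hC : IsCut n γ α C := by
    refine ⟨fun i => by simp [C, rowSum_zero], fun k hk i => ?_, fun k i => ?_⟩
    · simp only [C, hsum _ k hk]
      rfl
    · have h₁ := ht.rowSum_le_succ i k
      have h₂ := ht.le_succ i k
      simp only [C, rowSum_succ]
      omega
  have hcut := hC.cut_fill
  have hcount : ∀ m i, rowCount γ α (fill γ α C) m i + t i m = t (i + 1) m := by
    intro m i
    have h := cut_succ γ α (fill γ α C) m i
    have h₁ := ht.rowSum_le_succ i m
    have h₂ := ht.le_succ i m
    have hCk : ∀ k, C k i = α i + (rowSum t (i + 1) k - rowSum t i k) := fun _ => rfl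
    rw [hcut, hCk, hCk, rowSum_succ, rowSum_succ] at h
    omega
  have hcomp : companion γ α (fill γ α C) = t := by
    funext i m
    induction i with
    | zero => exact (ht.zero m).symm
    | succ i ih => rw [companion_succ, ih, ← hcount m i, add_comm]
  have hγα : α ≤ γ := fun i => Nat.le_add_right _ _
  refine ⟨fill γ α C, (isLR_iff (hg.antitone_add_weight ht) hα hγα).2
    ⟨hC.rowFill_fill, ?_, ?_⟩, hcomp, ?_⟩
  · rw [← good_companion_iff, hcomp]
    exact hg
  · rw [hcomp]
    exact ht.succ_le
  · funext m
    rw [skewContent_eq (N := n), ← ht.top n le_rfl, ← hcomp]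
    · rfl
    · intro i hi
      rw [hγ, Pi.add_apply, ht.weight_eq_zero hi, add_zero]

end

/-! ### Semistandard tableaux and Gelfand–Tsetlin patterns -/

end LittlewoodRichardson

section

open LittlewoodRichardson

namespace SSYTP

/-- The Gelfand–Tsetlin pattern of a semistandard tableau. -/
noncomputable def pattern (P : SSYTP) : ℕ → ℕ → ℕ := cut P.shape (fun _ => 0) P.T

lemma antitone_shape (P : SSYTP) : Antitone P.shape := fun _ _ h => P.antitone _ _ h

lemma rowFill (P : SSYTP) : RowFill P.shape (fun _ => 0) P.T :=
  ((isSSYT_iff P.antitone_shape).1 P.ssyt).1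

lemma pattern_succ_le (P : SSYTP) (k i : ℕ) : P.pattern (k + 1) (i + 1) ≤ P.pattern k i :=
  ((isSSYT_iff P.antitone_shape).1 P.ssyt).2 k i

lemma ext_pattern {P Q : SSYTP} (hs : P.shape = Q.shape) (hp : P.pattern = Q.pattern) :
    P = Q := by
  have hP := P.rowFill
  have hQ := Q.rowFill
  obtain ⟨μ, T, h₁, h₂, h₃⟩ := P
  obtain ⟨ν, T', h₁', h₂', h₃'⟩ := Q
  obtain rfl : μ = ν := hs
  obtain rfl : T = T' := hP.ext_cut hQ hp
  rfl

lemma isGT_pattern_of_lt {P : SSYTP} {n : ℕ}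
    (h : ∀ i j, j < P.shape i → P.T i j < n) : IsGT n P.shape P.pattern := by
  refine ⟨fun i => cut_zero _ _ _ _, fun k hk i => ?_, fun k i => ?_, P.pattern_succ_le⟩
  · exact cut_eq_of_forall_lt (fun _ => Nat.zero_le _) fun j _ hj => (h i j hj).trans_le hk
  · rw [pattern, cut_succ]
    exact Nat.le_add_right _ _

lemma weight_pattern {P : SSYTP} {n : ℕ} (h : IsGT n P.shape P.pattern) :
    weight n P.pattern = P.cont := by
  funext k
  have h₁ : rowSum P.pattern (k + 1) n = rowSum P.pattern k n + P.cont k := by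
    rw [cont, skewContent_eq (N := n) fun i hi => (h.top_eq_zero hi).le, rowSum, rowSum,
      ← sum_add_distrib]
    exact sum_congr rfl fun i _ => cut_succ _ _ _ _ _
  rw [weight, h₁, Nat.add_sub_cancel_left]

lemma isGT_pattern {P : SSYTP} {n : ℕ} (h : ∀ k, n ≤ k → P.cont k = 0) :
    IsGT n P.shape P.pattern := by
  refine isGT_pattern_of_lt fun i j hj => ?_
  by_contra! hT
  obtain ⟨N, hN⟩ := P.finite
  have hi : i < N := by
    by_contra! hi
    rw [hN i hi] at hj
    exact Nat.not_lt_zero _ hj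
  have h₀ := h _ hT
  rw [cont, skewContent_eq (N := N) fun i hi => (hN i hi).le, sum_eq_zero_iff] at h₀
  have h₁ := card_eq_zero.1 (h₀ i (mem_range.2 hi))
  exact filter_eq_empty_iff.1 h₁ (mem_Ico.2 ⟨Nat.zero_le j, hj⟩) rfl

lemma exists_cont_eq_zero (P : SSYTP) : ∃ n, ∀ k, n ≤ k → P.cont k = 0 := by
  obtain ⟨N, hN⟩ := P.finite
  refine ⟨((range N).sup fun i => (range (P.shape i)).sup (P.T i)) + 1, fun k hk => ?_⟩
  rw [cont, skewContent_eq (N := N) fun i hi => (hN i hi).le, sum_eq_zero_iff]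
  intro i hi
  refine card_eq_zero.2 (filter_eq_empty_iff.2 fun j hj => ?_)
  rw [mem_Ico] at hj
  have h₁ : P.T i j ≤ (range (P.shape i)).sup (P.T i) := le_sup (mem_range.2 hj.2)
  have h₂ := le_sup (f := fun i => (range (P.shape i)).sup (P.T i)) hi
  have h₃ := h₁.trans h₂
  omega

lemma exists_pattern_eq {n : ℕ} {μ : ℕ → ℕ} {g : ℕ → ℕ → ℕ} (h : IsGT n μ g) :
    ∃ P : SSYTP, P.shape = μ ∧ P.pattern = g := by
  have hC : IsCut n μ (fun _ => 0) g := ⟨h.zero, h.top, h.le_succ⟩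
  exact ⟨⟨μ, fill μ (fun _ => 0) g, fun _ _ hij => h.top_antitone hij,
    ⟨n, fun _ hi => h.top_eq_zero hi⟩,
    (isSSYT_iff h.top_antitone).2 ⟨hC.rowFill_fill, by rw [hC.cut_fill]; exact h.succ_le⟩⟩,
    rfl, hC.cut_fill⟩

end SSYTP

end

namespace LittlewoodRichardson

/-! ### The product of two tableaux -/

/-- A Littlewood–Richardson filling of a skew shape with outer shape `γ`. -/
structure LRStep (γ : ℕ → ℕ) where
  base : ℕ → ℕ
  antitone : Antitone base
  le : base ≤ γ
  T : ℕ → ℕ → ℕ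
  lr : IsLR γ base T

namespace LRStep

variable {γ : ℕ → ℕ}

/-- The content of a Littlewood–Richardson filling. -/
noncomputable def cont (s : LRStep γ) : ℕ → ℕ := skewContent γ s.base s.T

/-- The companion pattern of a Littlewood–Richardson filling. -/
noncomputable def pattern (s : LRStep γ) : ℕ → ℕ → ℕ := companion γ s.base s.T

lemma rowFill (s : LRStep γ) : RowFill γ s.base s.T := ⟨s.lr.1, s.lr.2.1⟩

lemma ext_pattern {s t : LRStep γ} (hb : s.base = t.base) (hp : s.pattern = t.pattern) :
    s = t := by
  have hs := s.rowFill
  have ht := t.rowFill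
  obtain ⟨b, T, h₁, h₂, h₃⟩ := s
  obtain ⟨b', h₁', h₂', T', h₃'⟩ := t
  obtain rfl : b = b' := hb
  obtain rfl : _ = T' := hs.ext_companion ht hp
  rfl

end LRStep

/-- The shapes of two tableaux and their total content. -/
noncomputable def pairType (x : SSYTP × SSYTP) : (ℕ → ℕ) × (ℕ → ℕ) × (ℕ → ℕ) :=
  (x.1.shape, x.2.shape, x.1.cont + x.2.cont)

/-- The inner shape and content of a Littlewood–Richardson filling and the content of a tableau
of its outer shape. -/
noncomputable def stepType (y : Σ R : SSYTP, LRStep R.shape) : (ℕ → ℕ) × (ℕ → ℕ) × (ℕ → ℕ) :=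
  (y.2.base, y.2.cont, y.1.cont)

section

variable {n : ℕ} {α β c : ℕ → ℕ}

lemma isGT_of_pairType {x : SSYTP × SSYTP} (hx : pairType x = (α, β, c))
    (hc : ∀ k, n ≤ k → c k = 0) :
    IsGT n α x.1.pattern ∧ IsGT n β x.2.pattern ∧
      ∀ k, weight n x.1.pattern k + weight n x.2.pattern k = c k := by
  simp only [pairType, Prod.mk.injEq] at hx
  obtain ⟨rfl, rfl, rfl⟩ := hx
  have h₁ : IsGT n x.1.shape x.1.pattern :=
    SSYTP.isGT_pattern fun k hk => (Nat.add_eq_zero_iff.1 (hc k hk)).1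
  have h₂ : IsGT n x.2.shape x.2.pattern :=
    SSYTP.isGT_pattern fun k hk => (Nat.add_eq_zero_iff.1 (hc k hk)).2
  refine ⟨h₁, h₂, fun k => ?_⟩
  rw [SSYTP.weight_pattern h₁, SSYTP.weight_pattern h₂]
  rfl

lemma isGT_of_stepType {y : Σ R : SSYTP, LRStep R.shape} (hy : stepType y = (α, β, c))
    (hc : ∀ k, n ≤ k → c k = 0) :
    IsGT n β y.2.pattern ∧ Good α y.2.pattern ∧
      α + weight n y.2.pattern = y.1.shape ∧ IsGT n y.1.shape y.1.pattern ∧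
        weight n y.1.pattern = c := by
  obtain ⟨R, s⟩ := y
  simp only [stepType, Prod.mk.injEq] at hy
  obtain ⟨rfl, rfl, rfl⟩ := hy
  have hR := SSYTP.isGT_pattern hc
  have hR₀ : ∀ i, n ≤ i → R.shape i = 0 := fun i hi => hR.top_eq_zero hi
  exact ⟨isGT_companion hR.top_antitone s.antitone s.le hR₀ s.lr,
    good_companion_iff.2 ((isLR_iff hR.top_antitone s.antitone s.le).1 s.lr).2.1,
    add_weight_companion hR.top_antitone s.antitone s.le hR₀ s.lr, hR, SSYTP.weight_pattern hR⟩

lemma nonempty_pairType_equiv_patternPairs (hc : ∀ k, n ≤ k → c k = 0) :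
    Nonempty ({x // pairType x = (α, β, c)} ≃ PatternPairs n α β c) := by
  refine ⟨Equiv.ofBijective
    (fun x => ⟨(x.1.1.pattern, x.1.2.pattern), isGT_of_pairType x.2 hc⟩) ⟨?_, ?_⟩⟩
  · rintro ⟨⟨P, Q⟩, hx⟩ ⟨⟨P', Q'⟩, hx'⟩ h
    obtain ⟨h₁, h₂⟩ := Prod.mk.inj (Subtype.mk.inj h)
    simp only [pairType, Prod.mk.injEq] at hx hx'
    obtain rfl : P = P' := SSYTP.ext_pattern (hx.1.trans hx'.1.symm) h₁
    obtain rfl : Q = Q' := SSYTP.ext_pattern (hx.2.1.trans hx'.2.1.symm) h₂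
    rfl
  · rintro ⟨⟨g, g'⟩, hg, hg', hw⟩
    obtain ⟨P, rfl, rfl⟩ := SSYTP.exists_pattern_eq hg
    obtain ⟨Q, rfl, rfl⟩ := SSYTP.exists_pattern_eq hg'
    refine ⟨⟨(P, Q), ?_⟩, rfl⟩
    simp only [SSYTP.weight_pattern hg, SSYTP.weight_pattern hg'] at hw
    simp only [pairType, Prod.mk.injEq, true_and]
    exact funext hw

lemma nonempty_stepType_equiv_goodPairs (hα : Antitone α) (hc : ∀ k, n ≤ k → c k = 0) :
    Nonempty ({y // stepType y = (α, β, c)} ≃ GoodPairs n α β c) := by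
  refine ⟨Equiv.ofBijective (fun y => ⟨(y.1.2.pattern, y.1.1.pattern), ?_⟩) ⟨?_, ?_⟩⟩
  · obtain ⟨h₁, h₂, h₃, h₄, h₅⟩ := isGT_of_stepType y.2 hc
    refine ⟨h₁, h₂, ?_, congrFun h₅⟩
    rw [h₃]
    exact h₄
  · rintro ⟨⟨R, s⟩, hy⟩ ⟨⟨R', s'⟩, hy'⟩ h
    obtain ⟨hs, hR⟩ := Prod.mk.inj (Subtype.mk.inj h)
    have h₁ : α + weight n s.pattern = R.shape := (isGT_of_stepType hy hc).2.2.1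
    have h₂ : α + weight n s'.pattern = R'.shape := (isGT_of_stepType hy' hc).2.2.1
    obtain rfl : R = R' := SSYTP.ext_pattern (by rw [← h₁, ← h₂, hs]) hR
    simp only [stepType, Prod.mk.injEq] at hy hy'
    obtain rfl : s = s' := LRStep.ext_pattern (hy.1.trans hy'.1.symm) hs
    rfl
  · rintro ⟨⟨t, g⟩, ht, hgood, hg, hw⟩
    obtain ⟨T, hT, hcomp, hcont⟩ := exists_isLR_of_good hα ht hgood
    obtain ⟨R, hR, rfl⟩ := SSYTP.exists_pattern_eq hg
    simp only at hR hg hw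
    rw [← hR] at hT hcomp hcont hg
    refine ⟨⟨⟨R, α, hα, fun i => ?_, T, hT⟩, ?_⟩, ?_⟩
    · rw [hR]
      exact Nat.le_add_right _ _
    · simp only [stepType, LRStep.cont, hcont, Prod.mk.injEq, true_and]
      rw [← SSYTP.weight_pattern hg]
      exact funext hw
    · exact Subtype.ext (Prod.ext hcomp rfl)

end

lemma nonempty_pairType_equiv_stepType (τ : (ℕ → ℕ) × (ℕ → ℕ) × (ℕ → ℕ)) :
    Nonempty ({x // pairType x = τ} ≃ {y // stepType y = τ}) := by
  obtain ⟨α, β, c⟩ := τ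
  have empty_equiv : IsEmpty {x // pairType x = (α, β, c)} →
      IsEmpty {y // stepType y = (α, β, c)} →
        Nonempty ({x // pairType x = (α, β, c)} ≃ {y // stepType y = (α, β, c)}) :=
    fun _ _ => ⟨Equiv.equivOfIsEmpty _ _⟩
  by_cases hc : ∃ n, ∀ k, n ≤ k → c k = 0
  · obtain ⟨n, hc⟩ := hc
    by_cases hα : Antitone α ∧ ∀ i, n ≤ i → α i = 0
    · obtain ⟨e₁⟩ := nonempty_pairType_equiv_patternPairs (α := α) (β := β) hc
      obtain ⟨e₂⟩ := nonempty_patternPairs_equiv_goodPairs hα.1 hα.2 hc β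
      obtain ⟨e₃⟩ := nonempty_stepType_equiv_goodPairs (β := β) hα.1 hc
      exact ⟨e₁.trans (e₂.trans e₃.symm)⟩
    · refine empty_equiv ⟨fun x => hα ?_⟩ ⟨fun y => hα ?_⟩
      · have h := (isGT_of_pairType x.2 hc).1
        exact ⟨h.top_antitone, fun i => h.top_eq_zero⟩
      · have hb : y.1.2.base = α := congrArg Prod.fst y.2
        have h := (isGT_of_stepType y.2 hc).2.2.2.1
        rw [← hb]
        exact ⟨y.1.2.antitone, fun i hi =>
          Nat.eq_zero_of_le_zero ((y.1.2.le i).trans (h.top_eq_zero hi).le)⟩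
  · refine empty_equiv ⟨fun x => hc ?_⟩ ⟨fun y => hc ?_⟩
    · have hx : x.1.1.cont + x.1.2.cont = c := congrArg (fun τ => τ.2.2) x.2
      obtain ⟨n₁, h₁⟩ := x.1.1.exists_cont_eq_zero
      obtain ⟨n₂, h₂⟩ := x.1.2.exists_cont_eq_zero
      refine ⟨max n₁ n₂, fun k hk => ?_⟩
      rw [← hx, Pi.add_apply, h₁ k (by omega), h₂ k (by omega)]
    · have hy : y.1.1.cont = c := congrArg (fun τ => τ.2.2) y.2
      rw [← hy]
      exact y.1.1.exists_cont_eq_zero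

/-- A shape- and content-compatible bijection between pairs of tableaux and tableaux with a
Littlewood–Richardson filling of an outer part of their shape. -/
lemma exists_product_equiv :
    ∃ e : SSYTP × SSYTP ≃ (Σ R : SSYTP, LRStep R.shape), ∀ x, stepType (e x) = pairType x := by
  let e := fun τ => (nonempty_pairType_equiv_stepType τ).some
  exact ⟨Equiv.ofFiberEquiv e, fun x => Equiv.ofFiberEquiv_map e x⟩

/-! ### Adding a step to a multitableau -/

section

variable {r : ℕ} {α : ℕ → ℕ}

/-- Extend a Littlewood–Richardson multitableau by a Littlewood–Richardson filling. -/
def snocStep (hα : Antitone α) (s : LRStep α) (M : LRMultiF r s.base) : LRMultiF (r + 1) α where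
  chain := Fin.snoc (α := fun _ => ℕ → ℕ) M.chain α
  antitone k := by
    induction k using Fin.lastCases with
    | last => simpa using fun i j h => hα h
    | cast k => simpa using M.antitone k
  zero i := by
    rw [← Fin.castSucc_zero, Fin.snoc_castSucc]
    exact M.zero i
  last i := by rw [Fin.snoc_last]
  mono k i := by
    induction k using Fin.lastCases with
    | last =>
      rw [Fin.succ_last, Fin.snoc_last, Fin.snoc_castSucc, M.last]
      exact s.le i
    | cast k =>
      rw [Fin.succ_castSucc, Fin.snoc_castSucc, Fin.snoc_castSucc]
      exact M.mono k i
  T := Fin.snoc (α := fun _ => ℕ → ℕ → ℕ) M.T s.T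
  lr k := by
    induction k using Fin.lastCases with
    | last =>
      rw [Fin.succ_last, Fin.snoc_last, Fin.snoc_castSucc, Fin.snoc_last, funext M.last]
      exact s.lr
    | cast k =>
      rw [Fin.succ_castSucc, Fin.snoc_castSucc, Fin.snoc_castSucc, Fin.snoc_castSucc]
      exact M.lr k

lemma cont_snocStep_last (hα : Antitone α) (s : LRStep α) (M : LRMultiF r s.base) :
    (snocStep hα s M).cont (Fin.last r) = s.cont := by
  simp only [LRMultiF.cont, snocStep]
  rw [Fin.succ_last, Fin.snoc_last, Fin.snoc_castSucc, Fin.snoc_last, funext M.last]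
  rfl

lemma cont_snocStep_castSucc (hα : Antitone α) (s : LRStep α) (M : LRMultiF r s.base)
    (k : Fin r) : (snocStep hα s M).cont k.castSucc = M.cont k := by
  simp only [LRMultiF.cont, snocStep]
  rw [Fin.succ_castSucc, Fin.snoc_castSucc, Fin.snoc_castSucc, Fin.snoc_castSucc]

lemma LRMultiF.ext_chain {M M' : LRMultiF r α} (hc : M.chain = M'.chain) (hT : M.T = M'.T) :
    M = M' := by
  obtain ⟨c, h₁, h₂, h₃, h₄, T, h₅⟩ := M
  obtain ⟨c', h₁', h₂', h₃', h₄', T', h₅'⟩ := M'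
  obtain rfl : c = c' := hc
  obtain rfl : T = T' := hT
  rfl

lemma snocStep_bijective (hα : Antitone α) : Function.Bijective
    fun x : Σ s : LRStep α, LRMultiF r s.base => snocStep hα x.1 x.2 := by
  constructor
  · rintro ⟨s, M⟩ ⟨s', M'⟩ h
    have hc : Fin.snoc (α := fun _ => ℕ → ℕ) M.chain α = Fin.snoc M'.chain α :=
      congrArg LRMultiF.chain h
    have hT : Fin.snoc (α := fun _ => ℕ → ℕ → ℕ) M.T s.T = Fin.snoc M'.T s'.T :=
      congrArg LRMultiF.T h
    have hc₁ := (Fin.snoc_injective2 hc).1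
    obtain ⟨hT₁, hT₂⟩ := Fin.snoc_injective2 hT
    have hb : s.base = s'.base := by
      rw [← funext M.last, ← funext M'.last, hc₁]
    obtain ⟨b, h₁, h₂, T, h₃⟩ := s
    obtain ⟨b', h₁', h₂', T', h₃'⟩ := s'
    obtain rfl : b = b' := hb
    obtain rfl : T = T' := hT₂
    obtain rfl : M = M' := LRMultiF.ext_chain hc₁ hT₁
    rfl
  · intro M
    have hl : M.chain (Fin.last r).succ = α := funext M.last
    let s : LRStep α :=
      { base := M.chain (Fin.last r).castSucc
        antitone := fun i j h => M.antitone _ i j h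
        le := fun i => (M.mono (Fin.last r) i).trans (M.last i).le
        T := M.T (Fin.last r)
        lr := by
          have h := M.lr (Fin.last r)
          rwa [hl] at h }
    let M₀ : LRMultiF r s.base :=
      { chain := fun k => M.chain k.castSucc
        antitone := fun k => M.antitone k.castSucc
        zero := M.zero
        last := fun _ => rfl
        mono := fun k => M.mono k.castSucc
        T := fun k => M.T k.castSucc
        lr := fun k => M.lr k.castSucc }
    refine ⟨⟨s, M₀⟩, LRMultiF.ext_chain ?_ (Fin.snoc_init_self M.T)⟩
    funext k
    induction k using Fin.lastCases with
    | last => exact (Fin.snoc_last (α := fun _ => ℕ → ℕ) α M₀.chain).trans hl.symm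
    | cast k => exact Fin.snoc_castSucc (α := fun _ => ℕ → ℕ) α M₀.chain k

end

lemma cont_cast {r : ℕ} {α β : ℕ → ℕ} (h : α = β) (M : LRMultiF r α) (k : Fin r) :
    (cast (congrArg (LRMultiF r) h) M).cont k = M.cont k := by
  subst h
  rfl

/-- The bijection for two tableaux, combined with a multitableau of the shape of the first. -/
lemma exists_snoc_equiv (r : ℕ) :
    ∃ e : (Σ P : SSYTP, LRMultiF r P.shape) × SSYTP ≃ (Σ R : SSYTP, LRMultiF (r + 1) R.shape),
      ∀ x, (e x).1.cont = x.1.1.cont + x.2.cont ∧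
        (e x).2.cont (Fin.last r) = x.2.shape ∧
          ∀ k : Fin r, (e x).2.cont k.castSucc = x.1.2.cont k := by
  obtain ⟨b, hb⟩ := exists_product_equiv
  have hbase : ∀ x, (b x).2.base = x.1.shape := fun x => congrArg Prod.fst (hb x)
  have hcont : ∀ x, (b x).2.cont = x.2.shape := fun x => congrArg (fun τ => τ.2.1) (hb x)
  have hsum : ∀ x, (b x).1.cont = x.1.cont + x.2.cont :=
    fun x => congrArg (fun τ => τ.2.2) (hb x)
  let e₁ : (Σ P : SSYTP, LRMultiF r P.shape) × SSYTP ≃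
      Σ x : SSYTP × SSYTP, LRMultiF r x.1.shape :=
    { toFun := fun x => ⟨(x.1.1, x.2), x.1.2⟩
      invFun := fun x => (⟨x.1.1, x.2⟩, x.1.2) }
  let e₂ : (Σ x : SSYTP × SSYTP, LRMultiF r x.1.shape) ≃
      Σ y : (Σ R : SSYTP, LRStep R.shape), LRMultiF r y.2.base :=
    b.sigmaCongr fun x => Equiv.cast (congrArg (LRMultiF r) (hbase x).symm)
  let e₃ := Equiv.sigmaAssoc fun (R : SSYTP) (s : LRStep R.shape) => LRMultiF r s.base
  let e₄ : (Σ R : SSYTP, Σ s : LRStep R.shape, LRMultiF r s.base) ≃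
      Σ R : SSYTP, LRMultiF (r + 1) R.shape :=
    Equiv.sigmaCongrRight fun R => Equiv.ofBijective _ (snocStep_bijective R.antitone_shape)
  refine ⟨e₁.trans (e₂.trans (e₃.trans e₄)), fun x => ?_⟩
  let y := b (x.1.1, x.2)
  have hy : x.1.1.shape = y.2.base := (hbase (x.1.1, x.2)).symm
  let M := cast (congrArg (LRMultiF r) hy) x.1.2
  exact ⟨hsum _, (cont_snocStep_last y.1.antitone_shape y.2 M).trans (hcont _),
    fun k => (cont_snocStep_castSucc y.1.antitone_shape y.2 M k).trans (cont_cast hy x.1.2 k)⟩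

lemma nonempty_equiv_lrMultiF_zero :
    Nonempty ((Fin 0 → SSYTP) ≃ (Σ P : SSYTP, LRMultiF 0 P.shape)) := by
  have hzero : IsSSYT (fun _ => 0) (fun _ _ => 0) :=
    ⟨fun _ _ _ => rfl, fun _ _ _ _ _ => le_rfl, fun _ _ _ _ h => (Nat.not_lt_zero _ h).elim⟩
  let x : Σ P : SSYTP, LRMultiF 0 P.shape :=
    ⟨⟨fun _ => 0, fun _ _ => 0, fun _ _ _ => le_rfl, ⟨0, fun _ _ => rfl⟩, hzero⟩,
      fun _ _ => 0, fun _ _ _ _ => le_rfl, fun _ => rfl, fun _ => rfl, fun k => k.elim0,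
      fun k => k.elim0, fun k => k.elim0⟩
  refine ⟨Equiv.ofBijective (fun _ => x) ⟨fun _ _ _ => Subsingleton.elim _ _, fun y => ?_⟩⟩
  refine ⟨Fin.elim0, ?_⟩
  obtain ⟨⟨μ, T, h₁, h₂, h₃⟩, c, h₄, h₅, h₆, h₇, U, h₈⟩ := y
  obtain rfl : μ = fun _ => 0 := funext fun i => (h₆ i).symm.trans (h₅ i)
  obtain rfl : T = fun _ _ => 0 := funext fun i => funext fun j => h₃.1 i j (Nat.zero_le j)
  refine Sigma.ext rfl (heq_of_eq (LRMultiF.ext_chain ?_ (Subsingleton.elim _ _)))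
  funext k i
  rw [Fin.fin_one_eq_zero k]
  exact (h₅ i).symm

end LittlewoodRichardson

/-- Thomas: bijection between `r`-tuples of semistandard Young tableaux
and pairs `(P, S)` of a semistandard tableau `P` and a Littlewood–Richardson
multitableau `S` of shape `sh(P)`, under which `cont P = ∑ cont P_k` and
`cont S = (sh P_1, …, sh P_r)`. -/
theorem stmt15 (r : ℕ) :
    ∃ e : (Fin r → SSYTP) ≃ (Σ P : SSYTP, LRMultiF r P.shape),
      ∀ Ps : Fin r → SSYTP,
        (∀ m, (e Ps).1.cont m = ∑ k, (Ps k).cont m) ∧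
        (∀ (k : Fin r) (m : ℕ), (e Ps).2.cont k m = (Ps k).shape m) := by
  open LittlewoodRichardson in
  induction r with
  | zero =>
    obtain ⟨e⟩ := nonempty_equiv_lrMultiF_zero
    refine ⟨e, fun Ps => ⟨fun m => ?_, fun k => k.elim0⟩⟩
    have hs : (e Ps).1.shape = fun _ => 0 :=
      funext fun i => ((e Ps).2.last i).symm.trans ((e Ps).2.zero i)
    rw [SSYTP.cont, skewContent_eq (N := 0) fun i _ => (congrFun hs i).le]
    simp
  | succ r ih =>
    obtain ⟨e, he⟩ := ih
    obtain ⟨e', he'⟩ := exists_snoc_equiv r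
    let s : (Fin (r + 1) → SSYTP) ≃ (Fin r → SSYTP) × SSYTP :=
      (Fin.snocEquiv fun _ => SSYTP).symm.trans (Equiv.prodComm _ _)
    refine ⟨s.trans ((e.prodCongr (Equiv.refl _)).trans e'), fun Ps => ?_⟩
    obtain ⟨hsum, hcont⟩ := he fun k => Ps k.castSucc
    obtain ⟨hsum', hlast, hcast⟩ := he' (e fun k => Ps k.castSucc, Ps (Fin.last r))
    refine ⟨fun m => ?_, fun k m => ?_⟩
    · rw [Fin.sum_univ_castSucc, ← hsum]
      exact congrFun hsum' m
    · induction k using Fin.lastCases with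
      | last => exact congrFun hlast m
      | cast k => exact (congrFun (hcast k) m).trans (hcont k m)
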